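/- Let m and n be positive integers with m ≥ n. Then for a generic f ∈ C([0,1]^m, ℝⁿ), for every y in the interior of f([0,1]^m) one has dim_T f⁻¹(y) = dim_H f⁻¹(y) = m − n and dim_P f⁻¹(y) = m. -/

import Mathlib

open Set Metric Filter Topology TopologicalSpace
open scoped ENNReal NNReal

noncomputable section

universe u

/-- `indBelow n X` means that the small inductive (topological) dimension of `X`
is at most `n - 1`; in particular `indBelow 0 X` means `X = ∅`. -/
def indBelow : ℕ → ∀ (X : Type u) [TopologicalSpace X], Prop
  | 0, X, _ => IsEmpty X
  | n + 1, X, inst =>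
      letI := inst
      ∀ (x : X) (U : Set X), IsOpen U → x ∈ U →
        ∃ V : Set X, IsOpen V ∧ x ∈ V ∧ V ⊆ U ∧ indBelow n ↥(frontier V)

/-- The small inductive (topological) dimension, with values in `EReal`:
`-1` for the empty space and `⊤` if there is no finite bound. -/
def indDim (X : Type u) [TopologicalSpace X] : EReal :=
  sInf {d : EReal | ∃ n : ℕ, indBelow n X ∧ d = (n : EReal) - 1}

variable {X : Type u} [MetricSpace X]

/-- Topological dimension of a subset of a metric space. -/
def tdim (A : Set X) : EReal := indDim ↥A

open Classical in
/-- Hausdorff dimension of a subset of a metric space,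
with the convention `dim ∅ = -1`. -/
def hdim (A : Set X) : EReal := if A = ∅ then -1 else ((dimH A : ℝ≥0∞) : EReal)

/-- A `δ`-packing of `A`: a countable family of pairwise disjoint closed balls
with centers in `A` and radii at most `δ`. -/
def IsPacking (A : Set X) (δ : ℝ≥0) (s : Set (X × ℝ≥0)) : Prop :=
  s.Countable ∧ (∀ p ∈ s, p.1 ∈ A ∧ p.2 ≤ δ) ∧
    s.Pairwise fun p q => Disjoint (closedBall p.1 (p.2 : ℝ)) (closedBall q.1 (q.2 : ℝ))

/-- The packing pre-measure `P^h_δ(A)`. -/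
def packPre (h : ℝ≥0 → ℝ≥0) (A : Set X) (δ : ℝ≥0) : ℝ≥0∞ :=
  ⨆ (s : Set (X × ℝ≥0)) (_ : IsPacking A δ s), ∑' p : s, ((h p.1.2 : ℝ≥0) : ℝ≥0∞)

/-- The packing pre-measure (packing number) `P^h₀(A) = lim_{δ → 0+} P^h_δ(A)`. -/
def packPre0 (h : ℝ≥0 → ℝ≥0) (A : Set X) : ℝ≥0∞ :=
  ⨅ (δ : ℝ≥0) (_ : 0 < δ), packPre h A δ

/-- The `h`-packing measure `𝒫^h(A)`. -/
def packMeasure (h : ℝ≥0 → ℝ≥0) (A : Set X) : ℝ≥0∞ :=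
  ⨅ (c : ℕ → Set X) (_ : A = ⋃ i, c i), ∑' i, packPre0 h (c i)

open Classical in
/-- The packing dimension, with the convention `dim ∅ = -1`. -/
def pdim (A : Set X) : EReal :=
  if A = ∅ then -1
  else max 0 (⨆ (s : ℝ≥0) (_ : packMeasure (fun r => r ^ (s : ℝ)) A = ∞), ((s : ℝ) : EReal))

/-- The restriction of the packing measure `𝒫^h` to `A` is σ-finite. -/
def PackSigmaFiniteOn (h : ℝ≥0 → ℝ≥0) (A : Set X) : Prop :=
  ∃ c : ℕ → Set X, A ⊆ ⋃ i, c i ∧ ∀ i, packMeasure h (A ∩ c i) < ∞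

/-- The generalized Hausdorff measure `ℋ^h(A)` associated to a gauge function `h`. -/
def hMeasure (h : ℝ≥0 → ℝ≥0) (A : Set X) : ℝ≥0∞ :=
  ⨆ (δ : ℝ≥0) (_ : 0 < δ),
    ⨅ (c : ℕ → Set X) (_ : A ⊆ ⋃ i, c i) (_ : ∀ i, EMetric.diam (c i) ≤ (δ : ℝ≥0∞)),
      ∑' i, ((h (EMetric.diam (c i)).toNNReal : ℝ≥0) : ℝ≥0∞)

/-- `F` is an `F_σ` subset of the subspace `A`. -/
def IsFSigmaIn (F A : Set X) : Prop :=
  ∃ C : ℕ → Set X, (∀ i, IsClosed (C i)) ∧ F = ⋃ i, C i ∩ A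

/-- `d^n_*(A) = inf {dim_*(A ∖ F) : F ⊆ A is F_σ in A and dim_T F ≤ n - 1}`. -/
def dStar (dim : Set X → EReal) (n : ℕ) (A : Set X) : EReal :=
  sInf {d : EReal |
    ∃ F : Set X, IsFSigmaIn F A ∧ tdim F ≤ (n : EReal) - 1 ∧ d = dim (A \ F)}

end

theorem exists_interpolation_det_one_add {E : Type*} [NormedAddCommGroup E] [NormedSpace ℝ E]
    [FiniteDimensional ℝ E] {t₀ : ℝ} (ht₀ : 0 < t₀) :
    ∃ (s : Finset ℝ) (w : ℝ → ℝ), (∀ t ∈ s, 0 ≤ t ∧ t ≤ t₀) ∧ ∑ t ∈ s, w t = 1 ∧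
      ∀ A : E →L[ℝ] E, (1 + A).det = ∑ t ∈ s, w t * (1 + t • A).det := by
  classical
  obtain ⟨s, hs, hcard⟩ := (Set.Icc_infinite ht₀).exists_subset_card_eq
    (Module.finrank ℝ E + 1)
  let w : ℝ → ℝ := fun t => (Lagrange.basis s id t).eval 1
  have key : ∀ A : E →L[ℝ] E, (1 + A).det = ∑ t ∈ s, w t * (1 + t • A).det := by
    intro A
    let b := Module.finBasis ℝ E
    let M := LinearMap.toMatrix b b (A : E →ₗ[ℝ] E)
    let P : Polynomial ℝ := Matrix.det ((Polynomial.X : Polynomial ℝ) • M.map Polynomial.C +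
      (1 : Matrix _ _ ℝ).map Polynomial.C)
    have hP : ∀ t : ℝ, P.eval t = (1 + t • A).det := by
      intro t
      have h1 : (1 + t • A).det = LinearMap.det (((1 + t • A : E →L[ℝ] E)) : E →ₗ[ℝ] E) := rfl
      rw [h1, ← LinearMap.det_toMatrix b]
      have h2 : LinearMap.toMatrix b b ((1 + t • A : E →L[ℝ] E) : E →ₗ[ℝ] E) = t • M + 1 := by
        have : ((1 + t • A : E →L[ℝ] E) : E →ₗ[ℝ] E) = LinearMap.id + t • (A : E →ₗ[ℝ] E) := rfl
        rw [this, map_add, map_smul, LinearMap.toMatrix_id, add_comm]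
      rw [h2]
      simp only [P]
      rw [← Polynomial.coe_evalRingHom, RingHom.map_det]
      congr 1
      ext i j
      by_cases hij : i = j <;>
        simp [RingHom.mapMatrix_apply, hij] <;> ring
    have hdeg : P.degree < s.card := by
      rw [hcard]
      refine lt_of_le_of_lt Polynomial.degree_le_natDegree ?_
      have := Polynomial.natDegree_det_X_add_C_le M 1
      simp only [Fintype.card_fin] at this
      exact_mod_cast Nat.lt_succ_of_le this
    have h := Lagrange.eq_interpolate (s := s) (v := id) (f := P) (injOn_id _) hdeg
    have h1 := congrArg (Polynomial.eval 1) h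
    rw [hP, one_smul, Lagrange.interpolate_apply, Polynomial.eval_finsetSum] at h1
    rw [h1]
    refine Finset.sum_congr rfl fun t _ => ?_
    simp [w, hP, mul_comm]
  refine ⟨s, w, fun t ht => hs ht, ?_, key⟩
  have := key 0
  simpa [ContinuousLinearMap.det] using this.symm

theorem det_one_add_smul_pos {E : Type*} [NormedAddCommGroup E] [NormedSpace ℝ E]
    [FiniteDimensional ℝ E] (A : E →L[ℝ] E) (hA : ‖A‖ < 1) : 0 < (1 + A).det := by
  have hne : ∀ s ∈ Icc (0 : ℝ) 1, (1 + s • A).det ≠ 0 := by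
    intro s hs
    have hn : ‖-(s • A)‖ < 1 := by
      rw [norm_neg, norm_smul, Real.norm_of_nonneg hs.1]
      nlinarith [norm_nonneg A, hs.2]
    have hu := isUnit_one_sub_of_norm_lt_one hn
    rw [sub_neg_eq_add] at hu
    have := hu.map (ContinuousLinearMap.toLinearMapRingHom (R₁ := ℝ) (M₁ := E))
    exact ((LinearMap.isUnit_iff_isUnit_det _).1 this).ne_zero
  have hc : Continuous fun s : ℝ => (1 + s • A).det :=
    ContinuousLinearMap.continuous_det.comp (by fun_prop)
  by_contra hneg
  push Not at hneg
  have h0 : (1 + (0 : ℝ) • A).det = 1 := by simp [ContinuousLinearMap.det]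
  obtain ⟨s, hs, hs0⟩ := intermediate_value_Icc' zero_le_one hc.continuousOn
    (show (0 : ℝ) ∈ Icc ((1 + (1 : ℝ) • A).det) ((1 + (0 : ℝ) • A).det) by
      rw [h0, one_smul]; exact ⟨hneg, zero_le_one⟩)
  exact hne s hs hs0

theorem exists_mem_segment_norm_eq {E : Type*} [NormedAddCommGroup E] [NormedSpace ℝ E]
    {R : ℝ} {x y : E} (hx : ‖x‖ ≤ R) (hy : R ≤ ‖y‖) : ∃ z, ‖z‖ = R ∧ dist x z ≤ dist x y := by
  have hc : Continuous fun s : ℝ => ‖AffineMap.lineMap x y s‖ := by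
    have : Continuous (AffineMap.lineMap x y : ℝ → E) := AffineMap.lineMap_continuous
    exact this.norm
  obtain ⟨s, hs, h⟩ := intermediate_value_Icc zero_le_one hc.continuousOn
    (show R ∈ Icc _ _ by simpa using ⟨hx, hy⟩)
  refine ⟨_, h, ?_⟩
  rw [dist_left_lineMap, Real.norm_of_nonneg hs.1]
  exact mul_le_of_le_one_left dist_nonneg hs.2

theorem lipschitzWith_indicator_closedBall {E : Type*} [NormedAddCommGroup E] [NormedSpace ℝ E]
    {R : ℝ} {v : E → E} {K : ℝ≥0} (hv : LipschitzOnWith K v (closedBall 0 R))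
    (h0 : ∀ x, ‖x‖ = R → v x = 0) : LipschitzWith K ((closedBall 0 R).indicator v) := by
  classical
  have aux : ∀ x y, x ∈ closedBall (0 : E) R → y ∉ closedBall (0 : E) R →
      dist (v x) 0 ≤ K * dist x y := by
    intro x y hx hy
    simp only [mem_closedBall, dist_zero_right, not_le] at hx hy
    obtain ⟨z, hz, hd⟩ := exists_mem_segment_norm_eq hx hy.le
    rw [← h0 z hz]
    exact (hv.dist_le_mul x (by simpa using hx) z (by simpa using hz.le)).trans (by gcongr)
  refine LipschitzWith.of_dist_le_mul fun x y => ?_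
  by_cases hx : x ∈ closedBall (0 : E) R <;> by_cases hy : y ∈ closedBall (0 : E) R
  · simpa only [indicator_of_mem, hx, hy] using hv.dist_le_mul x hx y hy
  · rw [indicator_of_mem hx, indicator_of_notMem hy]; exact aux x y hx hy
  · rw [indicator_of_notMem hx, indicator_of_mem hy, dist_comm, dist_comm x]; exact aux y x hy hx
  · rw [indicator_of_notMem hx, indicator_of_notMem hy, dist_self]; positivity

theorem not_forall_mem_ball_norm_add_eq {E : Type*} [NormedAddCommGroup E] [InnerProductSpace ℝ E]
    [FiniteDimensional ℝ E] [Nontrivial E] {R : ℝ} (hR : 0 < R) {v : E → E} (hv : ContDiff ℝ 1 v)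
    (h0 : ∀ x, ‖x‖ = R → v x = 0) : ¬ ∀ x ∈ ball (0 : E) R, ‖x + v x‖ = R := by
  intro h1
  let _ : MeasurableSpace E := borel E
  have _ : BorelSpace E := ⟨rfl⟩
  let μ : MeasureTheory.Measure E := MeasureTheory.Measure.addHaar
  have hcomp : IsCompact (closedBall (0 : E) R) := isCompact_closedBall 0 R
  obtain ⟨K, hK⟩ := hv.locallyLipschitz.locallyLipschitzOn.exists_lipschitzOnWith_of_compact hcomp
  have hw := lipschitzWith_indicator_closedBall hK h0
  set w := (closedBall (0 : E) R).indicator v with hwdef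
  have hDc : Continuous (fderiv ℝ v) := hv.continuous_fderiv one_ne_zero
  obtain ⟨C, hC⟩ := hcomp.exists_bound_of_continuousOn hDc.continuousOn
  have hC0 : 0 ≤ C := (norm_nonneg _).trans (hC 0 (by simp [hR.le]))
  obtain ⟨t₀, ht₀, htK, htC⟩ : ∃ t₀ : ℝ, 0 < t₀ ∧ t₀ * K < 1 ∧ t₀ * C < 1 := by
    refine ⟨(K + C + 1)⁻¹, by positivity, ?_, ?_⟩ <;>
    · rw [inv_mul_lt_iff₀ (by positivity)]
      linarith [K.coe_nonneg]
  have hball : ∀ x ∈ ball (0 : E) R, w x = v x := fun x hx =>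
    indicator_of_mem (ball_subset_closedBall hx) _
  have hout : ∀ x ∉ ball (0 : E) R, w x = 0 := by
    intro x hx
    by_cases hx' : x ∈ closedBall (0 : E) R
    · rw [hwdef, indicator_of_mem hx']
      refine h0 x (le_antisymm (by simpa using hx') (by simpa using hx))
    · exact indicator_of_notMem hx' _
  have hvol : ∀ t : ℝ, 0 ≤ t → t ≤ t₀ →
      ∫ x in ball (0 : E) R, (1 + t • fderiv ℝ v x).det ∂μ = μ.real (ball 0 R) := by
    intro t ht htt
    have hAL : ApproximatesLinearOn (fun x => x + t • w x)
        ((ContinuousLinearEquiv.refl ℝ E : E ≃L[ℝ] E) : E →L[ℝ] E) univ (t.toNNReal * K) := by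
      rw [ApproximatesLinearOn.approximatesLinearOn_iff_lipschitzOnWith, lipschitzOnWith_univ]
      refine LipschitzWith.of_dist_le_mul fun x y => ?_
      have := hw.dist_le_mul x y
      simp only [Pi.sub_apply, ContinuousLinearEquiv.coe_coe, ContinuousLinearEquiv.coe_refl', id,
        add_sub_cancel_left, dist_smul₀, Real.norm_of_nonneg ht, NNReal.coe_mul,
        Real.coe_toNNReal t ht, mul_assoc]
      gcongr
    have hc : Subsingleton E ∨ t.toNNReal * K <
        ‖((ContinuousLinearEquiv.refl ℝ E).symm : E →L[ℝ] E)‖₊⁻¹ := by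
      right
      have : ‖((ContinuousLinearEquiv.refl ℝ E).symm : E →L[ℝ] E)‖₊ = 1 := by
        ext; exact ContinuousLinearMap.norm_id
      rw [this, inv_one, ← NNReal.coe_lt_coe]
      simp only [NNReal.coe_mul, Real.coe_toNNReal t ht, NNReal.coe_one]
      exact (mul_le_mul_of_nonneg_right htt K.coe_nonneg).trans_lt htK
    have hinj : Function.Injective fun x => x + t • w x :=
      injOn_univ.1 (hAL.injOn hc)
    have hsurj := hAL.surjective hc
    have hfix : ∀ x ∉ ball (0 : E) R, x + t • w x = x := fun x hx => by simp [hout x hx]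
    have himg : (fun x => x + t • w x) '' ball (0 : E) R = ball 0 R := by
      ext y
      constructor
      · rintro ⟨x, hx, rfl⟩
        by_contra hy
        have := hinj (hfix _ hy)
        exact hy (by simpa [this] using hx)
      · intro hy
        obtain ⟨x, hx⟩ := hsurj y
        refine ⟨x, ?_, hx⟩
        by_contra hxn
        have := hfix x hxn
        simp only at hx
        rw [this] at hx
        exact hxn (hx ▸ hy)
    have hder : ∀ x ∈ ball (0 : E) R, HasFDerivWithinAt (fun x => x + t • w x)
        (1 + t • fderiv ℝ v x) (ball 0 R) x := by
      intro x hx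
      have h2 : HasFDerivAt (fun x => x + t • v x) (1 + t • fderiv ℝ v x) x :=
        (hasFDerivAt_id x).add (((hv.differentiable one_ne_zero) x).hasFDerivAt.const_smul t)
      exact h2.hasFDerivWithinAt.congr (fun z hz => by rw [hball z hz]) (by rw [hball x hx])
    have hcv := MeasureTheory.integral_image_eq_integral_abs_det_fderiv_smul μ
      measurableSet_ball hder hinj.injOn (fun _ => (1 : ℝ))
    rw [himg] at hcv
    simp only [MeasureTheory.setIntegral_const, smul_eq_mul, mul_one] at hcv
    rw [hcv]
    refine MeasureTheory.setIntegral_congr_fun measurableSet_ball fun x hx => ?_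
    refine (abs_of_pos (det_one_add_smul_pos _ ?_)).symm
    rw [norm_smul, Real.norm_of_nonneg ht]
    calc t * ‖fderiv ℝ v x‖ ≤ t₀ * C := by
          gcongr; exact hC x (ball_subset_closedBall hx)
      _ < 1 := htC
  obtain ⟨s, c, hs, hsum, hdet⟩ := exists_interpolation_det_one_add (E := E) ht₀
  have hdet_int : ∀ t : ℝ, MeasureTheory.IntegrableOn (fun x => (1 + t • fderiv ℝ v x).det)
      (ball 0 R) μ := fun t =>
    ((ContinuousLinearMap.continuous_det.comp
      (continuous_const.add (hDc.const_smul t))).continuousOn.integrableOn_compact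
        hcomp).mono_set ball_subset_closedBall
  have hone : ∫ x in ball (0 : E) R, (1 + fderiv ℝ v x).det ∂μ = μ.real (ball 0 R) := by
    simp only [fun x => hdet (fderiv ℝ v x)]
    rw [MeasureTheory.integral_finsetSum _ fun t _ => (hdet_int t).const_mul _]
    rw [Finset.sum_congr rfl fun t ht => by
      rw [MeasureTheory.integral_const_mul, hvol t (hs t ht).1 (hs t ht).2], ← Finset.sum_mul, hsum,
      one_mul]
  have hzero : ∀ x ∈ ball (0 : E) R, (1 + fderiv ℝ v x).det = 0 := by
    intro x hx
    by_contra hne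
    have hunit := (LinearMap.isUnit_iff_isUnit_det
      ((1 + fderiv ℝ v x : E →L[ℝ] E) : E →ₗ[ℝ] E)).2 (isUnit_iff_ne_zero.2 hne)
    have hsur := ((Module.End.isUnit_iff _).1 hunit).2
    obtain ⟨z, hz⟩ := hsur (x + v x)
    have hd : HasFDerivAt (fun x => x + v x) (1 + fderiv ℝ v x) x :=
      (hasFDerivAt_id x).add ((hv.differentiable one_ne_zero) x).hasFDerivAt
    have hd2 := hd.norm_sq
    have hconst : HasFDerivAt (fun x => ‖x + v x‖ ^ 2) (0 : E →L[ℝ] ℝ) x :=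
      (hasFDerivAt_const (R ^ 2) x).congr_of_eventuallyEq <| by
        filter_upwards [isOpen_ball.mem_nhds hx] with y hy
        rw [h1 y hy]
    have heq := congrArg (fun L : E →L[ℝ] ℝ => L z) (hd2.unique hconst)
    simp only [ContinuousLinearMap.coe_coe] at hz
    have heq' : 2 • inner ℝ (x + v x) ((1 + fderiv ℝ v x) z) = (0 : ℝ) := heq
    rw [hz, real_inner_self_eq_norm_sq, h1 x hx, nsmul_eq_mul] at heq'
    norm_num at heq'
    exact hR.ne' heq'
  rw [MeasureTheory.setIntegral_congr_fun measurableSet_ball hzero] at hone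
  have hpos : 0 < μ.real (ball (0 : E) R) :=
    ENNReal.toReal_pos (measure_ball_pos μ 0 hR).ne' MeasureTheory.measure_ball_lt_top.ne
  rw [MeasureTheory.integral_zero] at hone
  exact hpos.ne hone

theorem exists_add_eq_zero_of_bounded {E : Type*} [NormedAddCommGroup E] [InnerProductSpace ℝ E]
    [FiniteDimensional ℝ E] {u : E → E} (hu : Continuous u) {C : ℝ} (hC : ∀ x, ‖u x‖ ≤ C) :
    ∃ x, x + u x = 0 := by
  rcases subsingleton_or_nontrivial E with hE | hE
  · exact ⟨0, Subsingleton.elim _ _⟩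
  by_contra! hne
  have hC0 : 0 ≤ C := (norm_nonneg _).trans (hC 0)
  obtain ⟨g, hg, hgd, -⟩ := hu.exists_contDiff_approx (n := 1)
    (ε := fun x => min 1 ‖x + u x‖) (by fun_prop)
    (fun x => lt_min one_pos (norm_pos_iff.2 (hne x)))
  have hg0 : ∀ x, x + g x ≠ 0 := by
    intro x hx
    have h := (hgd x).trans_le (min_le_right _ _)
    rw [dist_eq_norm, ← norm_neg, show -(g x - u x) = x + u x - (x + g x) by abel, hx,
      sub_zero] at h
    exact lt_irrefl _ h
  have hgC : ∀ x, ‖g x‖ < C + 1 := by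
    intro x
    have h := (hgd x).trans_le (min_le_left _ _)
    have := norm_le_norm_add_norm_sub (u x) (g x)
    rw [dist_eq_norm, norm_sub_rev] at h
    linarith [hC x, norm_sub_rev (u x) (g x)]
  let χ : ContDiffBump (0 : E) := ⟨C + 1, C + 2, by linarith, by linarith⟩
  have hχ1 : ∀ x, ‖x‖ ≤ C + 1 → χ x = 1 := fun x hx => χ.one_of_mem_closedBall (by simpa using hx)
  have hχ0 : ∀ x, C + 2 ≤ ‖x‖ → χ x = 0 := fun x hx => χ.zero_of_le_dist (by simpa using hx)
  let G : E → E := fun x => x + χ x • g x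
  have hGs : ContDiff ℝ 1 G := contDiff_id.add (χ.contDiff.smul hg)
  have hG0 : ∀ x, G x ≠ 0 := by
    intro x hx
    rcases le_or_gt ‖x‖ (C + 1) with h | h
    · simp only [G, hχ1 x h, one_smul] at hx
      exact hg0 x hx
    · have h2 : ‖x‖ = ‖χ x • g x‖ := by
        conv_lhs => rw [eq_neg_of_add_eq_zero_left hx, norm_neg]
      rw [norm_smul, Real.norm_of_nonneg χ.nonneg] at h2
      have := mul_le_mul (χ.le_one (x := x)) (hgC x).le (norm_nonneg _) zero_le_one
      linarith
  have hR : 0 < C + 2 := by linarith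
  refine not_forall_mem_ball_norm_add_eq (E := E) (R := C + 2) hR
    (v := fun x => ((C + 2) * ‖G x‖⁻¹) • G x - x) ?_ ?_ ?_
  · exact ((contDiff_const.mul ((hGs.norm ℝ hG0).inv fun x => norm_ne_zero_iff.2 (hG0 x))).smul
      hGs).sub contDiff_id
  · intro x hx
    have hGx : G x = x := by simp [G, hχ0 x hx.ge]
    simp [hGx, hx, hR.ne']
  · intro x _
    rw [add_sub_cancel, norm_smul, norm_mul, norm_inv, norm_norm, mul_assoc,
      inv_mul_cancel₀ (norm_ne_zero_iff.2 (hG0 x)), mul_one, Real.norm_of_nonneg hR.le]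

/-- The Poincaré–Miranda theorem on the unit cube. -/
theorem poincare_miranda {ι : Type*} [Fintype ι] (H : C(Icc (0 : ι → ℝ) 1, ι → ℝ))
    (h0 : ∀ u j, u.1 j = 0 → H u j ≤ 0) (h1 : ∀ u j, u.1 j = 1 → 0 ≤ H u j) :
    ∃ u, H u = 0 := by
  let r : EuclideanSpace ℝ ι → Icc (0 : ι → ℝ) 1 := fun x =>
    ⟨fun j => max 0 (min 1 (x j)), fun _ => le_max_left _ _,
      fun _ => max_le zero_le_one (min_le_left _ _)⟩
  have hr : Continuous r := by
    refine Continuous.subtype_mk (continuous_pi fun j => ?_) _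
    have : Continuous fun x : EuclideanSpace ℝ ι => x j := by fun_prop
    fun_prop
  let U : Icc (0 : ι → ℝ) 1 → EuclideanSpace ℝ ι := fun u => WithLp.toLp 2 (H u - u.1)
  have hU : Continuous U := by fun_prop
  obtain ⟨C, hC⟩ := isCompact_univ.exists_bound_of_continuousOn hU.continuousOn
  obtain ⟨x, hx⟩ := exists_add_eq_zero_of_bounded (hU.comp hr) (fun x => hC (r x) trivial)
  have hxj : ∀ j, x j + (H (r x) j - max 0 (min 1 (x j))) = 0 := fun j =>
    congrArg (fun z : EuclideanSpace ℝ ι => z j) hx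
  refine ⟨r x, funext fun j => ?_⟩
  have h := hxj j
  rcases lt_or_ge (x j) 0 with h3 | h3
  · have h2 : max 0 (min 1 (x j)) = 0 := by simp [h3.le]
    have := h0 (r x) j h2
    linarith
  · rcases lt_or_ge 1 (x j) with h4 | h4
    · have h2 : max 0 (min 1 (x j)) = 1 := by simp [h4.le]
      have := h1 (r x) j h2
      linarith
    · rw [min_eq_right h4, max_eq_right h3] at h
      simpa using h

section

universe u

/-- Every map to `ℝ^d` can be uniformly approximated by maps without zeros on `F`. -/
def Avoidable (d : ℕ) {Z : Type*} [TopologicalSpace Z] (F : Set Z) : Prop :=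
  ∀ f : C(Z, Fin d → ℝ), ∀ ε > 0, ∃ g : C(Z, Fin d → ℝ),
    (∀ x, dist (g x) (f x) ≤ ε) ∧ ∀ x ∈ F, g x ≠ 0

theorem exists_extension_dist_le {Z E : Type*} [TopologicalSpace Z] [NormalSpace Z]
    [NormedAddCommGroup E] [NormedSpace ℝ E] [FiniteDimensional ℝ E]
    {F : Set Z} (hF : IsClosed F) (f : C(Z, E)) (g : C(F, E)) {ε : ℝ} (hε : 0 < ε)
    (h : ∀ x : F, dist (g x) (f x) ≤ ε) :
    ∃ G : C(Z, E), (∀ x : F, G x = g x) ∧ ∀ x, dist (G x) (f x) ≤ ε := by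
  have := Metric.instTietzeExtensionClosedBall ℝ (0 : E) hε
  obtain ⟨D, hD, hDr⟩ := ContinuousMap.exists_forall_mem_restrict_eq hF
    (g - f.restrict F) (t := closedBall (0 : E) ε) (fun x => by
      simpa [dist_eq_norm] using h x)
  refine ⟨f + D, fun x => ?_, fun x => ?_⟩
  · have := congrArg (fun k : C(F, E) => k x) hDr
    simp only [ContinuousMap.restrict_apply, ContinuousMap.sub_apply] at this
    simp [this]
  · simpa [dist_eq_norm] using hD x

theorem exists_extension {Z : Type*} {d : ℕ} [TopologicalSpace Z] [NormalSpace Z]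
    {F : Set Z} (hF : IsClosed F) (g : C(F, Fin d → ℝ)) :
    ∃ G : C(Z, Fin d → ℝ), ∀ x : F, G x = g x := by
  obtain ⟨G, hG⟩ := ContinuousMap.exists_restrict_eq hF g
  exact ⟨G, fun x => by rw [← hG]; rfl⟩

variable {Z : Type*} [TopologicalSpace Z] {d : ℕ}

theorem Avoidable.of_subtype [NormalSpace Z] {F : Set Z} (hF : IsClosed F)
    (h : Avoidable d (univ : Set F)) : Avoidable d F := by
  intro f ε hε
  obtain ⟨g, hg, hg0⟩ := h (f.restrict F) ε hε
  obtain ⟨G, hG, hGf⟩ := exists_extension_dist_le hF f g hε hg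
  exact ⟨G, hGf, fun x hx => by rw [hG ⟨x, hx⟩]; exact hg0 _ trivial⟩

theorem Avoidable.union {F F' : Set Z} (hF : IsCompact F) (h : Avoidable d F)
    (h' : Avoidable d F') : Avoidable d (F ∪ F') := by
  intro f ε hε
  obtain ⟨g, hg, hg0⟩ := h f (ε / 2) (by positivity)
  obtain ⟨η, hη, hηg⟩ : ∃ η > 0, ∀ x ∈ F, η ≤ ‖g x‖ := by
    rcases F.eq_empty_or_nonempty with rfl | hne
    · exact ⟨1, one_pos, by simp⟩
    · obtain ⟨x, hx, hmin⟩ := hF.exists_isMinOn hne (f := fun x => ‖g x‖) (by fun_prop)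
      exact ⟨‖g x‖, norm_pos_iff.2 (hg0 x hx), fun y hy => hmin hy⟩
  obtain ⟨k, hk, hk0⟩ := h' g (min (ε / 2) (η / 2)) (by positivity)
  refine ⟨k, fun x => ?_, ?_⟩
  · have := dist_triangle (k x) (g x) (f x)
    have h1 := (hk x).trans (min_le_left _ _)
    linarith [hg x]
  · rintro x (hx | hx)
    · intro h0
      have h1 := (hk x).trans (min_le_right _ _)
      rw [h0, dist_zero_left] at h1
      linarith [hηg x hx]
    · exact hk0 x hx

theorem Avoidable.empty : Avoidable d (∅ : Set Z) :=
  fun f ε hε => ⟨f, fun x => by simp [hε.le], by simp⟩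

theorem Avoidable.biUnion {ι : Type*} (t : Finset ι) {F : ι → Set Z}
    (hc : ∀ i ∈ t, IsCompact (F i)) (h : ∀ i ∈ t, Avoidable d (F i)) :
    Avoidable d (⋃ i ∈ t, F i) := by
  classical
  induction t using Finset.induction_on with
  | empty => simpa using Avoidable.empty
  | insert a s ha ih =>
    rw [Finset.set_biUnion_insert]
    exact (h a (by simp)).union (hc a (by simp))
      (ih (fun i hi => hc i (by simp [hi])) (fun i hi => h i (by simp [hi])))

theorem exists_continuous_of_isClopen_cover {ι : Type*} (t : Finset ι) {V : ι → Set Z}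
    (hV : ∀ i ∈ t, IsClopen (V i)) (p : Z → ℝ → Prop) (c : ι → ℝ)
    (hc : ∀ i ∈ t, ∀ x ∈ V i, p x (c i)) :
    ∃ h : C(Z, ℝ), ∀ i ∈ t, ∀ x ∈ V i, p x (h x) := by
  classical
  induction t using Finset.induction_on with
  | empty => exact ⟨0, by simp⟩
  | insert a s ha ih =>
    obtain ⟨h, hh⟩ := ih (fun i hi => hV i (by simp [hi])) (fun i hi => hc i (by simp [hi]))
    refine ⟨⟨(V a).piecewise (fun _ => c a) h, ?_⟩, ?_⟩
    · refine Continuous.piecewise ?_ continuous_const h.continuous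
      simp [(hV a (by simp)).frontier_eq]
    · intro i hi x hx
      simp only [ContinuousMap.coe_mk]
      by_cases hxa : x ∈ V a
      · simpa [hxa] using hc a (by simp) x hxa
      · rcases Finset.mem_insert.1 hi with rfl | hi
        · exact absurd hx hxa
        · simpa [hxa] using hh i hi x hx

theorem avoidable_univ_of_indBelow (d : ℕ) : ∀ (Z : Type u) [TopologicalSpace Z] [CompactSpace Z]
    [T2Space Z], indBelow d Z → Avoidable d (univ : Set Z) := by
  induction d with
  | zero =>
    intro Z _ _ _ h f ε hε
    have : IsEmpty Z := h
    exact ⟨f, fun x => isEmptyElim x, fun x => isEmptyElim x⟩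
  | succ d ih =>
    intro Z _ _ _ h f ε₀ hε₀
    set ε := ε₀ / 2 with hεdef
    have hε : 0 < ε := by positivity
    let f' : C(Z, Fin d → ℝ) := ⟨fun x i => f x i.succ, by fun_prop⟩
    have h1 : ∀ x : Z, ∃ V : Set Z, IsOpen V ∧ x ∈ V ∧ V ⊆ f ⁻¹' ball (f x) ε ∧
        indBelow d ↥(frontier V) :=
      fun x => h x (f ⁻¹' ball (f x) ε) (isOpen_ball.preimage f.continuous) (by simp [hε])
    choose V hVo hxV hVs hVd using h1
    obtain ⟨t, ht⟩ := isCompact_univ.elim_finite_subcover V hVo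
      (fun x _ => mem_iUnion.2 ⟨x, hxV x⟩)
    have hfr : Avoidable d (⋃ i ∈ t, frontier (V i)) := by
      refine Avoidable.biUnion t (fun i _ => isClosed_frontier.isCompact) (fun i _ => ?_)
      have : CompactSpace ↥(frontier (V i)) :=
        isCompact_iff_compactSpace.1 isClosed_frontier.isCompact
      exact Avoidable.of_subtype isClosed_frontier (ih _ (hVd i))
    obtain ⟨g', hg', hg'0⟩ := hfr f' ε hε
    set N : Set Z := g' ⁻¹' {0} with hN
    have hNc : IsClosed N := isClosed_singleton.preimage g'.continuous
    have hclop : ∀ i ∈ t, IsClopen ((Subtype.val : N → Z) ⁻¹' V i) := by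
      intro i hi
      refine ⟨?_, (hVo i).preimage continuous_subtype_val⟩
      have : (Subtype.val : N → Z) ⁻¹' V i = Subtype.val ⁻¹' closure (V i) := by
        refine Subset.antisymm (preimage_mono subset_closure) fun x hx => ?_
        by_contra hxV
        refine hg'0 x.1 (mem_biUnion hi ?_) x.2
        rw [(hVo i).frontier_eq]
        exact ⟨hx, hxV⟩
      rw [this]
      exact isClosed_closure.preimage continuous_subtype_val
    have hc : ∀ x : Z, ∃ c : ℝ, c ≠ 0 ∧ |c - f x 0| ≤ ε := by
      intro x
      by_cases hx : f x 0 = 0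
      · exact ⟨ε, hε.ne', by simp [hx, abs_of_pos hε]⟩
      · exact ⟨f x 0, hx, by simp [hε.le]⟩
    choose c hc0 hcf using hc
    obtain ⟨k, hk⟩ := exists_continuous_of_isClopen_cover t hclop
      (fun x a => a ≠ 0 ∧ |a - f x 0| ≤ ε₀) c (fun i _ x hx => by
        refine ⟨hc0 i, ?_⟩
        have h2 : dist (f x) (f i) < ε := hVs i hx
        have h3 := (dist_le_pi_dist (f x) (f i) 0).trans h2.le
        rw [Real.dist_eq, abs_sub_comm] at h3
        have h4 := abs_sub_le (c i) (f i 0) (f x 0)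
        linarith [hcf i])
    have hk' : ∀ x : N, k x ≠ 0 ∧ |k x - f x 0| ≤ ε₀ := by
      intro x
      obtain ⟨i, hi, hx⟩ := mem_iUnion₂.1 (ht (mem_univ x.1))
      exact hk i hi x hx
    obtain ⟨G, hG, hGf⟩ := exists_extension_dist_le hNc (⟨fun x => f x 0, by fun_prop⟩ : C(Z, ℝ))
      k hε₀ (fun x => (hk' x).2)
    refine ⟨⟨fun x => Fin.cons (G x) (g' x), ?_⟩, fun x => ?_, fun x _ h0 => ?_⟩
    · refine continuous_pi fun i => ?_
      refine Fin.cases ?_ (fun j => ?_) i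
      · simpa using G.continuous
      · simp only [Fin.cons_succ]; fun_prop
    · rw [dist_pi_le_iff hε₀.le]
      intro i
      refine Fin.cases ?_ (fun j => ?_) i
      · simpa using hGf x
      · have := (dist_le_pi_dist (g' x) (f' x) j).trans (hg' x)
        simp only [ContinuousMap.coe_mk, Fin.cons_succ]
        change dist (g' x j) (f x j.succ) ≤ ε at this
        linarith
    · have h0' : ∀ i, (Fin.cons (G x) (g' x) : Fin (d + 1) → ℝ) i = 0 := fun i => congrFun h0 i
      have hxN : x ∈ N := by
        rw [hN, mem_preimage, mem_singleton_iff]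
        ext j
        simpa using h0' j.succ
      have := h0' 0
      rw [Fin.cons_zero, hG ⟨x, hxN⟩] at this
      exact (hk' ⟨x, hxN⟩).1 this

theorem Avoidable.preimage [CompactSpace Z] [T2Space Z] {Y : Type*} [TopologicalSpace Y]
    [CompactSpace Y] [T2Space Y] {φ : Y → Z} (hφ : IsClosedEmbedding φ) {F : Set Z}
    (h : Avoidable d F) : Avoidable d (φ ⁻¹' F) := by
  intro f ε hε
  let e := hφ.isEmbedding.toHomeomorph
  obtain ⟨G, hG⟩ := exists_extension hφ.isClosed_range (f.comp (e.symm : C(range φ, Y)))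
  obtain ⟨g, hg, hg0⟩ := h G ε hε
  refine ⟨g.comp ⟨φ, hφ.continuous⟩, fun x => ?_, fun x hx => hg0 _ hx⟩
  have h1 := hG (e x)
  have h2 : ((e x : range φ) : Z) = φ x := rfl
  rw [h2] at h1
  have h3 := hg (φ x)
  rw [h1] at h3
  simpa using h3

end

/-- The unit cube in `ℝ^m`, with the maximum metric. -/
abbrev Cube (m : ℕ) : Type := ↥(Icc (0 : Fin m → ℝ) 1)

theorem Cube.nonneg {m : ℕ} (u : Cube m) (j : Fin m) : 0 ≤ u.1 j := u.2.1 j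

theorem Cube.le_one {m : ℕ} (u : Cube m) (j : Fin m) : u.1 j ≤ 1 := u.2.2 j

theorem Cube.continuous_apply {m : ℕ} (j : Fin m) : Continuous fun u : Cube m => u.1 j :=
  (_root_.continuous_apply j).comp continuous_subtype_val

/-- The map `h` is `c`-close to the affine map that sends `u` to
`y + r (2 u₁ - 1, …, 2 uₙ - 1)`. -/
def NearAffine {m n : ℕ} (hmn : n ≤ m) (r c : ℝ) (y : Fin n → ℝ) (h : Cube m → Fin n → ℝ) : Prop :=
  ∀ u i, |h u i - y i - r * (2 * u.1 (Fin.castLE hmn i) - 1)| ≤ c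

theorem NearAffine.le_zero {m n : ℕ} {hmn : n ≤ m} {r c : ℝ} {y : Fin n → ℝ}
    {h : Cube m → Fin n → ℝ} (H : NearAffine hmn r c y h) (hc : c ≤ r) {u : Cube m} {i : Fin n}
    (hu : u.1 (Fin.castLE hmn i) = 0) : h u i - y i ≤ 0 := by
  have := (abs_le.1 (H u i)).2
  rw [hu] at this
  linarith

theorem NearAffine.zero_le {m n : ℕ} {hmn : n ≤ m} {r c : ℝ} {y : Fin n → ℝ}
    {h : Cube m → Fin n → ℝ} (H : NearAffine hmn r c y h) (hc : c ≤ r) {u : Cube m} {i : Fin n}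
    (hu : u.1 (Fin.castLE hmn i) = 1) : 0 ≤ h u i - y i := by
  have := (abs_le.1 (H u i)).1
  rw [hu] at this
  linarith

theorem NearAffine.exists_eq_and {m n : ℕ} {hmn : n ≤ m} {r c : ℝ} {y : Fin n → ℝ}
    {h : C(Cube m, Fin n → ℝ)} (H : NearAffine hmn r c y h) (hc : c ≤ r)
    (g : C(Cube m, Fin (m - n) → ℝ))
    (h0 : ∀ (u : Cube m) (j : Fin m) (hj : n ≤ j), u.1 j = 0 → g u ⟨j - n, by omega⟩ ≤ 0)
    (h1 : ∀ (u : Cube m) (j : Fin m) (hj : n ≤ j), u.1 j = 1 → 0 ≤ g u ⟨j - n, by omega⟩) :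
    ∃ u, h u = y ∧ g u = 0 := by
  let P : C(Cube m, Fin m → ℝ) :=
    ⟨fun u j => if hj : (j : ℕ) < n then h u ⟨j, hj⟩ - y ⟨j, hj⟩ else g u ⟨j - n, by omega⟩, by
      refine continuous_pi fun j => ?_
      by_cases hj : (j : ℕ) < n
      · simp only [hj, dite_true]; fun_prop
      · simp only [hj, dite_false]; fun_prop⟩
  have hP : ∀ u j, P u j =
    if hj : (j : ℕ) < n then h u ⟨j, hj⟩ - y ⟨j, hj⟩ else g u ⟨j - n, by omega⟩ := fun _ _ => rfl
  obtain ⟨u, hu⟩ := poincare_miranda P (fun u j huj => by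
      rw [hP]
      split_ifs with hj
      · exact H.le_zero hc (i := ⟨j, hj⟩) huj
      · exact h0 u j (not_lt.1 hj) huj) (fun u j huj => by
      rw [hP]
      split_ifs with hj
      · exact H.zero_le hc (i := ⟨j, hj⟩) huj
      · exact h1 u j (not_lt.1 hj) huj)
  refine ⟨u, ?_, ?_⟩
  · ext i
    have h2 := congrFun hu (Fin.castLE hmn i)
    rw [hP] at h2
    simpa [sub_eq_zero] using h2
  · ext k
    have h2 := congrFun hu ⟨n + k, by omega⟩
    rw [hP] at h2
    simpa using h2

theorem NearAffine.not_avoidable {m n : ℕ} {hmn : n ≤ m} {r c : ℝ} {y : Fin n → ℝ}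
    {h : C(Cube m, Fin n → ℝ)} (H : NearAffine hmn r c y h) (hc : c ≤ r) :
    ¬ Avoidable (m - n) (h ⁻¹' {y}) := by
  intro hA
  obtain ⟨g, hg, hg0⟩ := hA ⟨fun u k => u.1 ⟨n + k, by omega⟩ - 1 / 2,
    continuous_pi fun k => (Cube.continuous_apply _).sub continuous_const⟩ (1 / 4)
    (by norm_num)
  have key : ∀ (u : Cube m) (j : Fin m) (hj : n ≤ j),
      |g u ⟨j - n, by omega⟩ - (u.1 j - 1 / 2)| ≤ 1 / 4 := by
    intro u j hj
    have h1 := (dist_le_pi_dist _ _ ⟨j - n, by omega⟩).trans (hg u)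
    rw [Real.dist_eq] at h1
    have h2 : (⟨n + (j - n), by omega⟩ : Fin m) = j := by ext; simp; omega
    simpa [h2] using h1
  obtain ⟨u, hu, hu0⟩ := H.exists_eq_and hc g
    (fun u j hj h0 => by
      have := (abs_le.1 (key u j hj)).2
      rw [h0] at this
      linarith)
    (fun u j hj h1 => by
      have := (abs_le.1 (key u j hj)).1
      rw [h1] at this
      linarith)
  exact hg0 u hu hu0

theorem NearAffine.exists_eq_of_coords {m n : ℕ} {hmn : n ≤ m} {r c : ℝ} {y : Fin n → ℝ}
    {h : C(Cube m, Fin n → ℝ)} (H : NearAffine hmn r c y h) (hc : c ≤ r)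
    (z : Fin (m - n) → ℝ) (hz : z ∈ Icc 0 1) :
    ∃ u : Cube m, h u = y ∧ ∀ k : Fin (m - n), u.1 ⟨n + k, by omega⟩ = z k := by
  obtain ⟨u, hu, hu0⟩ := H.exists_eq_and hc ⟨fun u k => u.1 ⟨n + k, by omega⟩ - z k,
    continuous_pi fun k => (Cube.continuous_apply _).sub continuous_const⟩
    (fun u j hj h0 => by
      have h2 : (⟨n + (j - n), by omega⟩ : Fin m) = j := by ext; simp; omega
      simpa [h2, h0] using hz.1 _)
    (fun u j hj h1 => by
      have h2 : (⟨n + (j - n), by omega⟩ : Fin m) = j := by ext; simp; omega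
      simpa [h2, h1] using hz.2 _)
  exact ⟨u, hu, fun k => sub_eq_zero.1 (congrFun hu0 k)⟩

theorem NearAffine.mem_range {m n : ℕ} {hmn : n ≤ m} {r c : ℝ} {y : Fin n → ℝ}
    {h : C(Cube m, Fin n → ℝ)} (H : NearAffine hmn r c y h) (hc : c ≤ r) : y ∈ range h := by
  obtain ⟨u, hu, -⟩ := H.exists_eq_of_coords hc 0 ⟨le_rfl, zero_le_one⟩
  exact ⟨u, hu⟩

theorem NearAffine.mem_interior_range {m n : ℕ} {hmn : n ≤ m} {r c : ℝ} {y : Fin n → ℝ}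
    {h : C(Cube m, Fin n → ℝ)} (H : NearAffine hmn r c y h) (hc : c < r) :
    y ∈ interior (range h) := by
  rw [mem_interior_iff_mem_nhds, Metric.mem_nhds_iff]
  refine ⟨r - c, sub_pos.2 hc, fun z hz => ?_⟩
  refine NearAffine.mem_range (hmn := hmn) (r := r) (c := r) (fun u i => ?_) le_rfl
  have h1 := (dist_le_pi_dist z y i).trans (mem_ball.1 hz).le
  rw [Real.dist_eq] at h1
  have h2 := abs_le.1 h1
  have h3 := abs_le.1 (H u i)
  rw [abs_le]
  constructor <;> linarith [h2.1, h2.2, h3.1, h3.2]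

theorem NearAffine.le_dimH {m n : ℕ} {hmn : n ≤ m} {r c : ℝ} {y : Fin n → ℝ}
    {h : C(Cube m, Fin n → ℝ)} (H : NearAffine hmn r c y h) (hc : c ≤ r) :
    ((m - n : ℕ) : ℝ≥0∞) ≤ dimH (h ⁻¹' {y}) := by
  let π : Cube m → Fin (m - n) → ℝ := fun u k => u.1 ⟨n + k, by omega⟩
  have hπ : LipschitzWith 1 π := by
    refine LipschitzWith.of_dist_le_mul fun u v => ?_
    rw [NNReal.coe_one, one_mul, dist_pi_le_iff dist_nonneg]
    exact fun k => dist_le_pi_dist u.1 v.1 _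
  have h1 : Icc (0 : Fin (m - n) → ℝ) 1 ⊆ π '' (h ⁻¹' {y}) := by
    intro z hz
    obtain ⟨u, hu, huz⟩ := H.exists_eq_of_coords hc z hz
    exact ⟨u, hu, funext huz⟩
  have h2 : dimH (Icc (0 : Fin (m - n) → ℝ) 1) = ((m - n : ℕ) : ℝ≥0∞) := by
    rw [Real.dimH_of_nonempty_interior]
    · simp
    · have : Icc (0 : Fin (m - n) → ℝ) 1 = Set.pi univ fun _ => Icc 0 1 := by
        rw [Set.pi_univ_Icc]; rfl
      rw [this, interior_pi_set finite_univ]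
      exact ⟨fun _ => 1 / 2, fun i _ => by
        change (1 / 2 : ℝ) ∈ interior (Icc (0 : ℝ) 1)
        rw [interior_Icc]
        norm_num⟩
  rw [← h2]
  exact (dimH_mono h1).trans (hπ.dimH_image_le _)

/-- Consequences for the fiber of `f` of the existence of a small copy of the cube on which `f` is
close to an affine map. -/
theorem NearAffine.fiber {m n : ℕ} {hmn : n ≤ m} {r c : ℝ} {y : Fin n → ℝ}
    {f : C(Cube m, Fin n → ℝ)} {φ : Cube m → Cube m} {κ : ℝ≥0} (hφc : Continuous φ)
    (hφ : AntilipschitzWith κ φ)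
    (H : NearAffine hmn r c y (f ∘ φ)) (hc : c < r) :
    y ∈ interior (f '' range φ) ∧ ¬ indBelow (m - n) ↥(f ⁻¹' {y}) ∧
      ((m - n : ℕ) : ℝ≥0∞) ≤ dimH (f ⁻¹' {y}) := by
  let h : C(Cube m, Fin n → ℝ) := f.comp ⟨φ, hφc⟩
  have H' : NearAffine hmn r c y h := H
  have hcl : IsClosed (f ⁻¹' {y}) := isClosed_singleton.preimage f.continuous
  refine ⟨?_, fun hi => ?_, ?_⟩
  · have := H'.mem_interior_range hc
    rwa [← range_comp]
  · have : CompactSpace ↥(f ⁻¹' {y}) := isCompact_iff_compactSpace.1 hcl.isCompact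
    refine H'.not_avoidable hc.le ?_
    exact ((avoidable_univ_of_indBelow _ _ hi).of_subtype hcl).preimage
      (hφc.isClosedEmbedding hφ.injective)
  · refine (H'.le_dimH hc.le).trans ((hφ.le_dimH_image _).trans (dimH_mono ?_))
    rintro _ ⟨u, hu, rfl⟩
    exact hu

section

universe u

open MeasureTheory MeasureTheory.Measure in
theorem ae_hausdorffMeasure_sphere_eq_zero {X : Type*} [MetricSpace X] [MeasurableSpace X]
    [BorelSpace X] (d : ℕ) (h : μH[((d + 1 : ℕ) : ℝ)] (univ : Set X) = 0) (x : X) :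
    ∀ᵐ r : ℝ, μH[(d : ℝ)] (sphere x r) = 0 := by
  have h1 : ∀ k : ℕ, ∃ t : ℕ → Set X, univ ⊆ ⋃ i, t i ∧
      (∀ i, ediam (t i) ≤ ((k : ℝ≥0∞) + 1)⁻¹) ∧
      ∑' i, (⨆ _ : (t i).Nonempty, ediam (t i) ^ ((d + 1 : ℕ) : ℝ)) < ((k : ℝ≥0∞) + 1)⁻¹ := by
    intro k
    have hk : (0 : ℝ≥0∞) < ((k : ℝ≥0∞) + 1)⁻¹ := by
      simp
    rw [hausdorffMeasure_apply, ENNReal.iSup_eq_zero] at h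
    have h2 := h ((k : ℝ≥0∞) + 1)⁻¹
    rw [ENNReal.iSup_eq_zero] at h2
    have h3 := (h2 hk).trans_lt hk
    simp only [iInf_lt_iff] at h3
    obtain ⟨t, ht, ht', h4⟩ := h3
    exact ⟨t, ht, ht', h4⟩
  choose t htc htd hts using h1
  let D : X → ℝ := fun y => dist y x
  have hD : LipschitzWith 1 D := LipschitzWith.dist_left x
  let φ : ℕ → ℝ → ℝ≥0∞ := fun k r =>
    ∑' i, (closure (D '' t k i)).indicator (fun _ => ediam (t k i) ^ (d : ℝ)) r
  have hφm : ∀ k, Measurable (φ k) := fun k =>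
    Measurable.tsum fun i => measurable_const.indicator isClosed_closure.measurableSet
  have hφi : ∀ k, ∫⁻ r, φ k r ≤ ((k : ℝ≥0∞) + 1)⁻¹ := by
    intro k
    refine le_trans ?_ (hts k).le
    rw [lintegral_tsum fun i =>
      (measurable_const.indicator isClosed_closure.measurableSet).aemeasurable]
    refine ENNReal.tsum_le_tsum fun i => ?_
    rw [lintegral_indicator_const isClosed_closure.measurableSet]
    rcases (t k i).eq_empty_or_nonempty with he | hne
    · simp [he]
    · simp only [hne, iSup_pos]
      have h2 : volume (closure (D '' t k i)) ≤ ediam (t k i) := by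
        refine (Real.volume_le_diam _).trans ?_
        rw [ediam_closure]
        simpa using hD.ediam_image_le (t k i)
      rw [ENNReal.rpow_natCast, ENNReal.rpow_natCast, pow_succ]
      gcongr
  have hlim : Tendsto (fun k : ℕ => ((k : ℝ≥0∞) + 1)⁻¹) atTop (𝓝 0) := by
    have := (tendsto_add_atTop_iff_nat 1).2 ENNReal.tendsto_inv_nat_nhds_zero
    simpa using this
  have hF : ∫⁻ r, liminf (fun k => φ k r) atTop = 0 := by
    refine le_antisymm ((lintegral_liminf_le hφm).trans ?_) zero_le
    rw [← hlim.liminf_eq]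
    exact liminf_le_liminf (Eventually.of_forall hφi)
  rw [lintegral_eq_zero_iff (Measurable.liminf hφm)] at hF
  filter_upwards [hF] with r hr
  refine le_antisymm ?_ zero_le
  rw [← show liminf (fun k => φ k r) atTop = 0 from hr]
  refine (hausdorffMeasure_le_liminf_tsum (ι := fun k => ↥{i | r ∈ closure (D '' t k i)})
    (d : ℝ) (sphere x r) (l := atTop) _ hlim (fun k i => t k i)
    (Eventually.of_forall fun k i => htd k i) (Eventually.of_forall fun k y hy => ?_)).trans ?_
  · obtain ⟨i, hi⟩ := mem_iUnion.1 (htc k (mem_univ y))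
    exact mem_iUnion.2 ⟨⟨i, subset_closure ⟨y, hi, hy⟩⟩, hi⟩
  · refine liminf_le_liminf (Eventually.of_forall fun k => ?_)
    rw [tsum_subtype {i | r ∈ closure (D '' t k i)} (fun i => ediam (t k i) ^ (d : ℝ))]
    refine le_of_eq (tsum_congr fun i => ?_)
    by_cases hi : r ∈ closure (D '' t k i) <;> simp [hi]

open MeasureTheory MeasureTheory.Measure in
theorem indBelow_of_hausdorffMeasure_eq_zero (d : ℕ) : ∀ (X : Type u) [MetricSpace X]
    [MeasurableSpace X] [BorelSpace X], μH[(d : ℝ)] (univ : Set X) = 0 → indBelow d X := by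
  induction d with
  | zero =>
    intro X _ _ _ h
    refine ⟨fun x => ?_⟩
    have h1 : μH[((0 : ℕ) : ℝ)] ({x} : Set X) ≤ 0 := (measure_mono (subset_univ _)).trans h.le
    rw [Nat.cast_zero, hausdorffMeasure_zero_singleton] at h1
    simp at h1
  | succ d ih =>
    intro X _ _ _ h x U hU hx
    obtain ⟨R, hR, hRU⟩ := Metric.isOpen_iff.1 hU x hx
    have h1 := Measure.dense_of_ae (ae_hausdorffMeasure_sphere_eq_zero d h x)
    obtain ⟨r, hr, hr0, hrR⟩ := h1.exists_between hR
    refine ⟨ball x r, isOpen_ball, mem_ball_self hr0, (ball_subset_ball hrR.le).trans hRU, ?_⟩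
    refine ih _ ?_
    rw [← isometry_subtype_coe.hausdorffMeasure_image (Or.inl (Nat.cast_nonneg d)), image_univ,
      Subtype.range_coe]
    exact le_antisymm ((measure_mono (frontier_ball_subset_sphere)).trans_eq hr) zero_le

theorem indBelow_succ (d : ℕ) : ∀ (X : Type u) [TopologicalSpace X], indBelow d X →
    indBelow (d + 1) X := by
  induction d with
  | zero =>
    intro X _ h x
    exact (h.false x).elim
  | succ d ih =>
    intro X _ h x U hU hx
    obtain ⟨V, hV, hxV, hVU, hd⟩ := h x U hU hx
    exact ⟨V, hV, hxV, hVU, ih _ hd⟩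

theorem indBelow_mono {d d' : ℕ} (hd : d ≤ d') (X : Type u) [TopologicalSpace X]
    (h : indBelow d X) : indBelow d' X := by
  induction d', hd using Nat.le_induction with
  | base => exact h
  | succ k _ ih => exact indBelow_succ k X ih

theorem indBelow_of_dimH_le {X : Type u} [MetricSpace X] (A : Set X) (d : ℕ)
    (h : dimH A ≤ d) : indBelow (d + 1) ↥A := by
  borelize X
  refine indBelow_of_hausdorffMeasure_eq_zero (d + 1) _ ?_
  rw [← isometry_subtype_coe.hausdorffMeasure_image (Or.inl (Nat.cast_nonneg _)), image_univ,
    Subtype.range_coe]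
  have : dimH A < ((d + 1 : ℕ) : ℝ≥0) := by
    refine h.trans_lt ?_
    exact_mod_cast Nat.lt_succ_self d
  simpa using hausdorffMeasure_of_dimH_lt this

theorem indDim_eq_of_indBelow {X : Type u} [TopologicalSpace X] (d : ℕ)
    (h : indBelow (d + 1) X) (h' : ¬ indBelow d X) : indDim X = d := by
  refine le_antisymm (sInf_le ⟨d + 1, h, ?_⟩) (le_sInf ?_)
  · have : ((d : ℝ) : EReal) = (((d + 1 : ℕ) : ℝ) : EReal) - ((1 : ℝ) : EReal) := by
      rw [← EReal.coe_sub]; simp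
    simpa using this
  · rintro _ ⟨k, hk, rfl⟩
    have hdk : d + 1 ≤ k := by
      by_contra hlt
      exact h' (indBelow_mono (by omega) X hk)
    have : ((d : ℝ) : EReal) ≤ ((k : ℝ) : EReal) - ((1 : ℝ) : EReal) := by
      rw [← EReal.coe_sub, EReal.coe_le_coe_iff]
      have : ((d + 1 : ℕ) : ℝ) ≤ k := by exact_mod_cast hdk
      push_cast at this
      linarith
    simpa using this

end

section

/-- The `j`-th coordinate of the cell map with index `k`: the affine bijection of `[0,1]` onto
`[k / (2M), (k + 1) / (2M)]` that preserves orientation if and only if `k` is even. -/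
noncomputable def cellCoord (M k : ℕ) (t : ℝ) : ℝ :=
  (k + if Even k then t else 1 - t) / (2 * M)

theorem cellCoord_mem {M k : ℕ} (hM : 0 < M) {t : ℝ} (ht : t ∈ Icc (0 : ℝ) 1) :
    cellCoord M k t ∈ Icc ((k : ℝ) / (2 * M)) ((k + 1) / (2 * M)) := by
  have hM' : (0 : ℝ) < M := by exact_mod_cast hM
  unfold cellCoord
  constructor
  · gcongr
    split_ifs <;> linarith [ht.1, ht.2]
  · gcongr
    split_ifs <;> linarith [ht.1, ht.2]

theorem cellCoord_mem_unit {M k : ℕ} (hM : 0 < M) (hk : k < 2 * M) {t : ℝ}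
    (ht : t ∈ Icc (0 : ℝ) 1) : cellCoord M k t ∈ Icc (0 : ℝ) 1 := by
  have hM' : (0 : ℝ) < M := by exact_mod_cast hM
  obtain ⟨h1, h2⟩ := cellCoord_mem (k := k) hM ht
  refine ⟨le_trans (by positivity) h1, h2.trans ?_⟩
  rw [div_le_one (by positivity)]
  exact_mod_cast hk

theorem abs_cellCoord_sub {M k : ℕ} (s t : ℝ) :
    |cellCoord M k s - cellCoord M k t| = (2 * M : ℝ)⁻¹ * |s - t| := by
  have : (0 : ℝ) ≤ (2 * M : ℝ)⁻¹ := by positivity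
  rw [← abs_of_nonneg this, ← abs_mul]
  unfold cellCoord
  split_ifs
  · congr 1; ring
  · rw [← abs_neg]; congr 1; ring

theorem norm_mul_cellCoord {M k : ℕ} (hM : 0 < M) {t : ℝ} (ht : t ∈ Icc (0 : ℝ) 1) :
    ‖((M * cellCoord M k t : ℝ) : UnitAddCircle)‖ = t / 2 := by
  have hM' : (0 : ℝ) < M := by exact_mod_cast hM
  have h2 : ‖((t / 2 : ℝ) : UnitAddCircle)‖ = t / 2 := by
    rw [(AddCircle.norm_coe_eq_abs_iff 1 one_ne_zero).2, abs_of_nonneg]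
    · linarith [ht.1]
    · rw [abs_of_nonneg (by linarith [ht.1])]
      simpa using by linarith [ht.2]
  have hz : ∀ a : ℕ, ((a : ℝ) : UnitAddCircle) = 0 := fun a => by
    rw [AddCircle.coe_eq_zero_iff]
    exact ⟨a, by simp⟩
  unfold cellCoord
  rcases Nat.even_or_odd k with hk | hk
  · obtain ⟨a, rfl⟩ := hk
    rw [if_pos ⟨a, rfl⟩]
    have : (M : ℝ) * (((a + a : ℕ) + t) / (2 * M)) = a + t / 2 := by
      push_cast; field_simp; ring
    rw [this, AddCircle.coe_add, hz, zero_add, h2]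
  · rw [if_neg (Nat.not_even_iff_odd.2 hk)]
    obtain ⟨a, rfl⟩ := hk
    have : (M : ℝ) * (((2 * a + 1 : ℕ) + (1 - t)) / (2 * M)) = ((a + 1 : ℕ) : ℝ) - t / 2 := by
      push_cast; field_simp; ring
    rw [this, AddCircle.coe_sub, hz, zero_sub, norm_neg, h2]

theorem exists_nat_lt_mem_Icc {P : ℕ} (hP : 0 < P) {y : ℝ} (h0 : 0 ≤ y) (h1 : y ≤ P) :
    ∃ a < P, y ∈ Icc (a : ℝ) (a + 1) := by
  rcases eq_or_lt_of_le h1 with rfl | hlt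
  · refine ⟨P - 1, by omega, ?_⟩
    rw [Nat.cast_sub (by omega)]
    constructor <;> push_cast <;> linarith
  · exact ⟨⌊y⌋₊, (Nat.floor_lt h0).2 hlt, Nat.floor_le h0, (Nat.lt_floor_add_one y).le⟩

theorem exists_cellCoord_eq {M k : ℕ} (hM : 0 < M) {x : ℝ}
    (hx : x ∈ Icc ((k : ℝ) / (2 * M)) ((k + 1) / (2 * M))) :
    ∃ t ∈ Icc (0 : ℝ) 1, cellCoord M k t = x := by
  have hM' : (0 : ℝ) < M := by exact_mod_cast hM
  obtain ⟨h1, h2⟩ := hx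
  rw [div_le_iff₀ (by positivity)] at h1
  rw [le_div_iff₀ (by positivity)] at h2
  by_cases he : Even k
  · refine ⟨x * (2 * M) - k, ⟨by linarith, by linarith⟩, ?_⟩
    rw [cellCoord, if_pos he]
    field_simp
    ring
  · refine ⟨1 - (x * (2 * M) - k), ⟨by linarith, by linarith⟩, ?_⟩
    rw [cellCoord, if_neg he, sub_sub_cancel]
    field_simp
    ring

/-- The cell maps of the partition of the cube into `(2M)^m` congruent cubes. -/
noncomputable def cell {m M : ℕ} (hM : 0 < M) (k : Fin m → Fin (2 * M)) (u : Cube m) : Cube m :=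
  ⟨fun j => cellCoord M (k j) (u.1 j),
    fun j => (cellCoord_mem_unit hM (k j).2 ⟨u.nonneg j, u.le_one j⟩).1,
    fun j => (cellCoord_mem_unit hM (k j).2 ⟨u.nonneg j, u.le_one j⟩).2⟩

variable {m M : ℕ} (hM : 0 < M) (k : Fin m → Fin (2 * M))

theorem dist_cell (u v : Cube m) : dist (cell hM k u) (cell hM k v) = (2 * M : ℝ)⁻¹ * dist u v := by
  have hM' : (0 : ℝ) < M := by exact_mod_cast hM
  refine le_antisymm ?_ ?_
  · refine (dist_pi_le_iff (by positivity)).2 fun j => ?_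
    rw [Real.dist_eq]
    refine (abs_cellCoord_sub _ _).trans_le ?_
    gcongr
    exact dist_le_pi_dist u.1 v.1 j
  · rw [inv_mul_le_iff₀ (by positivity)]
    refine (dist_pi_le_iff (by positivity)).2 fun j => ?_
    rw [← inv_mul_le_iff₀ (by positivity), Real.dist_eq, ← abs_cellCoord_sub (k := k j)]
    exact dist_le_pi_dist (cell hM k u).1 (cell hM k v).1 j

theorem lipschitzWith_cell : LipschitzWith (2 * M : ℝ≥0)⁻¹ (cell hM k) :=
  LipschitzWith.of_dist_le_mul fun u v => by
    rw [dist_cell]; simp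

theorem antilipschitzWith_cell : AntilipschitzWith (2 * M : ℝ≥0) (cell hM k) :=
  AntilipschitzWith.of_le_mul_dist fun u v => by
    have hM' : (0 : ℝ) < M := by exact_mod_cast hM
    rw [dist_cell]
    push_cast
    rw [mul_inv_cancel_left₀ (by positivity)]

theorem continuous_cell : Continuous (cell hM k) := (lipschitzWith_cell hM k).continuous

/-- The cells of the partition of the cube into `(2M)^m` congruent cubes. -/
def cellSet (k : Fin m → Fin (2 * M)) : Set (Cube m) :=
  {x | ∀ j, x.1 j ∈ Icc ((k j : ℝ) / (2 * M)) ((k j + 1) / (2 * M))}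

theorem range_cell : range (cell hM k) = cellSet k := by
  ext x
  constructor
  · rintro ⟨u, rfl⟩ j
    exact cellCoord_mem hM ⟨u.nonneg j, u.le_one j⟩
  · intro hx
    choose t ht htx using fun j => exists_cellCoord_eq hM (hx j)
    exact ⟨⟨t, fun j => (ht j).1, fun j => (ht j).2⟩, Subtype.ext (funext htx)⟩

theorem isCompact_cellSet : IsCompact (cellSet k) := by
  rcases Nat.eq_zero_or_pos M with rfl | hM
  · rcases isEmpty_or_nonempty (Fin m) with h | ⟨⟨j⟩⟩
    · exact (Set.toFinite _).isCompact
    · exact (k j).elim0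
  · rw [← range_cell hM]
    exact isCompact_range (continuous_cell hM k)

theorem exists_mem_cellSet (hM : 0 < M) (x : Cube m) : ∃ k : Fin m → Fin (2 * M), x ∈ cellSet k := by
  have hM' : (0 : ℝ) < M := by exact_mod_cast hM
  choose k hk hkx using fun j => exists_nat_lt_mem_Icc (P := 2 * M) (y := x.1 j * (2 * M))
    (by omega) (mul_nonneg (x.nonneg j) (by positivity))
    (by push_cast; exact mul_le_of_le_one_left (by positivity) (x.le_one j))
  refine ⟨fun j => ⟨k j, hk j⟩, fun j => ⟨?_, ?_⟩⟩
  · rw [div_le_iff₀ (by positivity)]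
    exact (hkx j).1
  · rw [le_div_iff₀ (by positivity)]
    exact (hkx j).2

theorem exists_cell_eq (x : Cube m) : ∃ k : Fin m → Fin (2 * M), ∃ u, cell hM k u = x := by
  obtain ⟨k, hk⟩ := exists_mem_cellSet hM x
  rw [← range_cell hM] at hk
  exact ⟨k, hk⟩

theorem dist_le_of_mem_cellSet {k : Fin m → Fin (2 * M)} {x y : Cube m} (hx : x ∈ cellSet k)
    (hy : y ∈ cellSet k) : dist x y ≤ (2 * M : ℝ)⁻¹ := by
  refine (dist_pi_le_iff (by positivity)).2 fun j => ?_
  have h : ((k j : ℝ) + 1) / (2 * M) = k j / (2 * M) + (2 * M : ℝ)⁻¹ := by ring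
  have h1 := hx j
  have h2 := hy j
  rw [h] at h1 h2
  rw [Real.dist_eq, abs_le]
  constructor <;> linarith [h1.1, h1.2, h2.1, h2.2]

/-- The index of the subcell with relative position `a`, with respect to the subdivision of the
sides of the cell with index `k` into `P` equal pieces. -/
def subIndex {P : ℕ} (k : Fin m → Fin (2 * M)) (a : Fin m → Fin P) : Fin m → Fin (2 * (M * P)) :=
  fun j => ⟨k j * P + a j, by
    have h1 := (a j).2
    have h2 : (k j + 1) * P ≤ 2 * M * P := Nat.mul_le_mul_right P (k j).2
    calc k j * P + a j < (k j + 1) * P := by linarith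
      _ ≤ 2 * (M * P) := by linarith⟩

theorem cellSet_subIndex_subset {P : ℕ} (k : Fin m → Fin (2 * M)) (a : Fin m → Fin P) :
    cellSet (subIndex k a) ⊆ cellSet k := by
  intro x hx j
  have hM' : (0 : ℝ) < M := by
    have := (k j).2
    exact_mod_cast (by omega : 0 < M)
  have hP' : (0 : ℝ) < P := by
    have := (a j).2
    exact_mod_cast (by omega : 0 < P)
  obtain ⟨h1, h2⟩ := hx j
  simp only [subIndex] at h1 h2
  push_cast at h1 h2
  rw [div_le_iff₀ (by positivity)] at h1
  rw [le_div_iff₀ (by positivity)] at h2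
  have h3 : ((a j : ℕ) : ℝ) + 1 ≤ P := by exact_mod_cast (a j).2
  have h4 : (0 : ℝ) ≤ (a j : ℕ) := by positivity
  constructor
  · rw [div_le_iff₀ (by positivity)]
    refine le_of_mul_le_mul_right ?_ hP'
    linarith
  · rw [le_div_iff₀ (by positivity)]
    refine le_of_mul_le_mul_right ?_ hP'
    linarith

theorem exists_mem_cellSet_subIndex {P : ℕ} (hM : 0 < M) (hP : 0 < P) {k : Fin m → Fin (2 * M)}
    {x : Cube m} (hx : x ∈ cellSet k) : ∃ a : Fin m → Fin P, x ∈ cellSet (subIndex k a) := by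
  have hM' : (0 : ℝ) < M := by exact_mod_cast hM
  have hP' : (0 : ℝ) < P := by exact_mod_cast hP
  have h : ∀ j, ∃ a < P, x.1 j * (2 * (M * P)) - k j * P ∈ Icc (a : ℝ) (a + 1) := by
    intro j
    obtain ⟨h1, h2⟩ := hx j
    rw [div_le_iff₀ (by positivity)] at h1
    rw [le_div_iff₀ (by positivity)] at h2
    refine exists_nat_lt_mem_Icc hP ?_ ?_ <;> nlinarith
  choose a ha hax using h
  refine ⟨fun j => ⟨a j, ha j⟩, fun j => ⟨?_, ?_⟩⟩
  · simp only [subIndex]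
    push_cast
    rw [div_le_iff₀ (by positivity)]
    linarith [(hax j).1]
  · simp only [subIndex]
    push_cast
    rw [le_div_iff₀ (by positivity)]
    linarith [(hax j).2]

theorem three_mul_le_dist_of_ne {P : ℕ} (k : Fin m → Fin (2 * M)) {b b' : Fin m → Fin P}
    (hb : b ≠ b') {x x' : Cube m}
    (hx : x ∈ cellSet (subIndex k fun j => (⟨4 * b j, by omega⟩ : Fin (4 * P))))
    (hx' : x' ∈ cellSet (subIndex k fun j => (⟨4 * b' j, by omega⟩ : Fin (4 * P)))) :
    3 * (2 * (M * (4 * P) : ℕ) : ℝ)⁻¹ ≤ dist x x' := by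
  obtain ⟨j, hj⟩ := Function.ne_iff.1 hb
  wlog hlt : b j < b' j generalizing b b' x x'
  · rw [dist_comm]
    exact this hb.symm hx' hx hj.symm (lt_of_le_of_ne (not_lt.1 hlt) hj.symm)
  refine le_trans ?_ (dist_le_pi_dist x.1 x'.1 j)
  rw [Real.dist_eq, abs_sub_comm]
  refine le_trans ?_ (le_abs_self _)
  have h1 := (hx j).2
  have h2 := (hx' j).1
  have h3 : ((b j : ℕ) : ℝ) + 1 ≤ (b' j : ℕ) := by exact_mod_cast hlt
  simp only [subIndex] at h1 h2
  rw [div_eq_mul_inv] at h1 h2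
  have h4 : (0 : ℝ) ≤ (2 * (M * (4 * P) : ℕ) : ℝ)⁻¹ := by positivity
  generalize (2 * (M * (4 * P) : ℕ) : ℝ)⁻¹ = w at *
  push_cast at h1 h2
  nlinarith

/-- A perturbation of `f` by zigzag functions of the first `n` coordinates. -/
noncomputable def zigzag {n : ℕ} (hmn : n ≤ m) (f : C(Cube m, Fin n → ℝ)) (r : ℝ) (M : ℕ) :
    C(Cube m, Fin n → ℝ) :=
  ⟨fun x i => f x i + r * (4 * ‖((M * x.1 (Fin.castLE hmn i) : ℝ) : UnitAddCircle)‖ - 1), by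
    refine continuous_pi fun i => ((continuous_apply i).comp f.continuous).add
      (continuous_const.mul ((continuous_const.mul (continuous_norm.comp
        ((AddCircle.continuous_mk' 1).comp (continuous_const.mul ?_)))).sub continuous_const))
    exact Cube.continuous_apply _⟩

theorem zigzag_cell {n : ℕ} (hmn : n ≤ m) (f : C(Cube m, Fin n → ℝ)) (r : ℝ) (u : Cube m)
    (i : Fin n) : zigzag hmn f r M (cell hM k u) i =
      f (cell hM k u) i + r * (2 * u.1 (Fin.castLE hmn i) - 1) := by
  change f (cell hM k u) i + r * (4 * ‖((M * cellCoord M (k (Fin.castLE hmn i))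
    (u.1 (Fin.castLE hmn i)) : ℝ) : UnitAddCircle)‖ - 1) = _
  rw [norm_mul_cellCoord hM ⟨u.nonneg _, u.le_one _⟩]
  ring

theorem dist_zigzag_le (hM : 0 < M) {n : ℕ} (hmn : n ≤ m) (f : C(Cube m, Fin n → ℝ))
    {r : ℝ} (hr : 0 ≤ r) : dist (zigzag hmn f r M) f ≤ r := by
  refine (ContinuousMap.dist_le hr).2 fun x => ?_
  obtain ⟨k, u, rfl⟩ := exists_cell_eq hM x
  refine (dist_pi_le_iff hr).2 fun i => ?_
  rw [zigzag_cell, Real.dist_eq, add_sub_cancel_left, abs_mul, abs_of_nonneg hr]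
  refine mul_le_of_le_one_right hr ?_
  rw [abs_le]
  constructor <;> linarith [u.nonneg (Fin.castLE hmn i), u.le_one (Fin.castLE hmn i)]

end

theorem exists_lipschitzWith_dist_le {m n : ℕ} (f : C(Cube m, Fin n → ℝ)) {ε : ℝ} (hε : 0 < ε) :
    ∃ (g : C(Cube m, Fin n → ℝ)) (L : ℝ≥0), LipschitzWith L g ∧ dist g f ≤ ε := by
  obtain ⟨F, hF⟩ := exists_extension isClosed_Icc f
  obtain ⟨G, hG, hGF, -⟩ := F.continuous.exists_contDiff_approx 1 (ε := fun _ => ε)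
    continuous_const (fun _ => hε)
  obtain ⟨L, hL⟩ := hG.contDiffOn.exists_lipschitzOnWith (by simp)
    (convex_Icc (0 : Fin m → ℝ) 1) isCompact_Icc
  refine ⟨⟨fun x => G x.1, hG.continuous.comp continuous_subtype_val⟩, L,
    lipschitzOnWith_iff_restrict.1 hL, (ContinuousMap.dist_le hε.le).2 fun x => ?_⟩
  rw [← hF x]
  exact (hGF x.1).le

theorem dist_le_dist_coords_of_zigzag_cell_eq {m n M : ℕ} (hM : 0 < M) {hmn : n ≤ m}
    {f : C(Cube m, Fin n → ℝ)} {L : ℝ≥0} (hf : LipschitzWith L f) {r : ℝ} (hLr : L < 4 * M * r)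
    (k : Fin m → Fin (2 * M)) {u v : Cube m}
    (huv : zigzag hmn f r M (cell hM k u) = zigzag hmn f r M (cell hM k v)) :
    dist u v ≤ dist (fun j : Fin (m - n) => u.1 ⟨n + j, by omega⟩)
      (fun j : Fin (m - n) => v.1 ⟨n + j, by omega⟩) := by
  set p := dist (fun j : Fin (m - n) => u.1 ⟨n + j, by omega⟩)
    (fun j : Fin (m - n) => v.1 ⟨n + j, by omega⟩) with hp
  have hM' : (0 : ℝ) < M := by exact_mod_cast hM
  have hr : 0 < r := by
    have h1 : 0 < 4 * M * r := L.2.trans_lt hLr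
    exact pos_of_mul_pos_right h1 (by positivity)
  by_contra! hlt
  have hD : 0 < dist u v := dist_nonneg.trans_lt hlt
  have hn : ∀ i : Fin n, 4 * M * r * |u.1 (Fin.castLE hmn i) - v.1 (Fin.castLE hmn i)| ≤
      L * dist u v := by
    intro i
    have h1 := congrFun huv i
    rw [zigzag_cell, zigzag_cell] at h1
    have h2 := (dist_le_pi_dist (f (cell hM k u)) (f (cell hM k v)) i).trans (hf.dist_le_mul _ _)
    rw [dist_cell, Real.dist_eq] at h2
    have h3 : f (cell hM k u) i - f (cell hM k v) i =
      -(2 * r) * (u.1 (Fin.castLE hmn i) - v.1 (Fin.castLE hmn i)) := by linarith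
    rw [h3, abs_mul, abs_neg, abs_of_pos (by positivity : 0 < 2 * r)] at h2
    have h4 : L * ((2 * M : ℝ)⁻¹ * dist u v) = (2 * M : ℝ)⁻¹ * (L * dist u v) := by ring
    rw [h4, le_inv_mul_iff₀ (by positivity)] at h2
    linarith
  have hq : L / (4 * M * r) < 1 := (div_lt_one (by positivity)).2 hLr
  have h5 : dist u v ≤ max p (L / (4 * M * r) * dist u v) := by
    refine (dist_pi_le_iff (by positivity)).2 fun j => ?_
    by_cases hj : (j : ℕ) < n
    · refine le_trans ?_ (le_max_right _ _)
      rw [div_mul_eq_mul_div, le_div_iff₀ (by positivity), mul_comm, Real.dist_eq]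
      exact hn ⟨j, hj⟩
    · refine le_trans ?_ (le_max_left _ _)
      have h6 : (⟨n + (j - n), by omega⟩ : Fin m) = j := by ext; simp; omega
      have h7 := dist_le_pi_dist (fun j : Fin (m - n) => u.1 ⟨n + j, by omega⟩)
        (fun j : Fin (m - n) => v.1 ⟨n + j, by omega⟩) ⟨j - n, by omega⟩
      simp only [h6] at h7
      exact h7
  rcases le_max_iff.1 h5 with h | h
  · exact absurd h (not_le.2 hlt)
  · nlinarith

theorem dimH_zigzag_fiber_le {m n M : ℕ} (hM : 0 < M) {hmn : n ≤ m}
    {f : C(Cube m, Fin n → ℝ)} {L : ℝ≥0} (hf : LipschitzWith L f) {r : ℝ} (hLr : L < 4 * M * r)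
    (y : Fin n → ℝ) : dimH (zigzag hmn f r M ⁻¹' {y}) ≤ ((m - n : ℕ) : ℝ≥0∞) := by
  let S : (Fin m → Fin (2 * M)) → Set (Cube m) := fun k =>
    {u | zigzag hmn f r M (cell hM k u) = y}
  have h1 : zigzag hmn f r M ⁻¹' {y} ⊆ ⋃ k, cell hM k '' S k := by
    intro x hx
    obtain ⟨k, u, rfl⟩ := exists_cell_eq hM x
    exact mem_iUnion.2 ⟨k, u, hx, rfl⟩
  refine (dimH_mono h1).trans ?_
  rw [dimH_iUnion]
  refine iSup_le fun k => ((lipschitzWith_cell hM k).dimH_image_le _).trans ?_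
  let π : S k → Fin (m - n) → ℝ := fun u j => u.1.1 ⟨n + j, by omega⟩
  have hπ : AntilipschitzWith 1 π := AntilipschitzWith.of_le_mul_dist fun u v => by
    rw [NNReal.coe_one, one_mul]
    exact dist_le_dist_coords_of_zigzag_cell_eq hM hf hLr k (u.2.trans v.2.symm)
  have h2 := (isometry_subtype_coe (s := S k)).dimH_image univ
  rw [image_univ, Subtype.range_coe] at h2
  rw [h2]
  refine (hπ.le_dimH_image _).trans ((dimH_mono (subset_univ _)).trans ?_)
  rw [Real.dimH_univ_pi]
  simp

open MeasureTheory MeasureTheory.Measure in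
theorem exists_isOpen_cover_of_hausdorffMeasure_eq_zero {X : Type*} [MetricSpace X]
    [MeasurableSpace X] [BorelSpace X] {A : Set X} {s : ℝ} (hs : 0 < s) (hA : μH[s] A = 0)
    {η : ℝ≥0∞} (hη : 0 < η) :
    ∃ U : ℕ → Set X, (∀ i, IsOpen (U i)) ∧ A ⊆ ⋃ i, U i ∧ ∑' i, ediam (U i) ^ s ≤ η := by
  wlog hη' : η ≠ ∞ generalizing η
  · obtain ⟨U, h1, h2, h3⟩ := this one_pos (by simp)
    exact ⟨U, h1, h2, by simp [not_not.1 hη']⟩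
  have hη2 : 0 < η / 2 := ENNReal.half_pos hη.ne'
  rw [hausdorffMeasure_apply, ENNReal.iSup_eq_zero] at hA
  have h2 := hA 1
  rw [ENNReal.iSup_eq_zero] at h2
  have h3 := (h2 one_pos).trans_lt hη2
  simp only [iInf_lt_iff] at h3
  obtain ⟨t, htA, htd, hts⟩ := h3
  have hts' : ∑' i, ediam (t i) ^ s ≤ η / 2 := by
    refine le_trans (ENNReal.tsum_le_tsum fun i => ?_) hts.le
    rcases (t i).eq_empty_or_nonempty with he | hne
    · simp [he, hs]
    · simp [hne]
  obtain ⟨ε, hε0, hε⟩ := ENNReal.exists_pos_sum_of_countable hη2.ne' ℕ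
  have h4 : ∀ i, ∃ δ : ℝ, 0 < δ ∧ ediam (thickening δ (t i)) ^ s ≤ ediam (t i) ^ s + ε i := by
    intro i
    have hfin : ediam (t i) ^ s ≠ ∞ :=
      ENNReal.rpow_ne_top_of_nonneg hs.le (ne_top_of_le_ne_top (by simp) (htd i))
    have hc : Tendsto (fun δ : ℝ≥0 => (ediam (t i) + 2 * (δ : ℝ≥0∞)) ^ s) (𝓝 0)
        (𝓝 (ediam (t i) ^ s)) := by
      have h5 : Continuous fun δ : ℝ≥0 => (ediam (t i) + 2 * (δ : ℝ≥0∞)) ^ s :=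
        ENNReal.continuous_rpow_const.comp (continuous_const.add
          ((ENNReal.continuous_const_mul (by simp)).comp ENNReal.continuous_coe))
      simpa using h5.tendsto 0
    have h6 := hc.eventually_lt_const (ENNReal.lt_add_right hfin
      (ENNReal.coe_ne_zero.2 (hε0 i).ne'))
    obtain ⟨δ, hδ, hδ'⟩ := ((h6.filter_mono nhdsWithin_le_nhds).and
      (self_mem_nhdsWithin : Ioi (0 : ℝ≥0) ∈ 𝓝[>] 0)).exists
    refine ⟨δ, hδ', le_trans ?_ hδ.le⟩
    gcongr
    exact ediam_thickening_le δ
  choose δ hδ0 hδ using h4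
  refine ⟨fun i => thickening (δ i) (t i), fun i => isOpen_thickening, htA.trans
    (iUnion_mono fun i => self_subset_thickening (hδ0 i) _), ?_⟩
  calc ∑' i, ediam (thickening (δ i) (t i)) ^ s ≤ ∑' i, (ediam (t i) ^ s + ε i) :=
        ENNReal.tsum_le_tsum hδ
    _ = ∑' i, ediam (t i) ^ s + ∑' i, (ε i : ℝ≥0∞) := ENNReal.tsum_add
    _ ≤ η / 2 + η / 2 := add_le_add hts' hε.le
    _ = η := ENNReal.add_halves η

open MeasureTheory MeasureTheory.Measure in
theorem hausdorffMeasure_eq_zero_of_forall_cover {X : Type*} [MetricSpace X]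
    [MeasurableSpace X] [BorelSpace X] {A : Set X} {s : ℝ} (hs : 0 < s)
    (h : ∀ k : ℕ, ∃ U : ℕ → Set X, A ⊆ ⋃ i, U i ∧ ∑' i, ediam (U i) ^ s ≤ ((k : ℝ≥0∞) + 1)⁻¹) :
    μH[s] A = 0 := by
  choose U hU hUs using h
  have hlim : Tendsto (fun k : ℕ => ((k : ℝ≥0∞) + 1)⁻¹) atTop (𝓝 0) := by
    have := (tendsto_add_atTop_iff_nat 1).2 ENNReal.tendsto_inv_nat_nhds_zero
    simpa using this
  have hlim' : Tendsto (fun k : ℕ => (((k : ℝ≥0∞) + 1)⁻¹) ^ (s⁻¹)) atTop (𝓝 0) := by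
    have := hlim.ennrpow_const s⁻¹
    rwa [ENNReal.zero_rpow_of_pos (inv_pos.2 hs)] at this
  refine le_antisymm ?_ zero_le
  refine (hausdorffMeasure_le_liminf_tsum s A _ hlim' U (Eventually.of_forall fun k i => ?_)
    (Eventually.of_forall hU)).trans ?_
  · rw [ENNReal.le_rpow_inv_iff hs]
    exact (ENNReal.le_tsum i).trans (hUs k)
  · rw [← hlim.liminf_eq]
    exact liminf_le_liminf (Eventually.of_forall hUs)

/-- Maps all of whose fibers over a ball of radius `R` have small `s`-dimensional content. -/
def SmallContent {K : Type*} [MetricSpace K] [CompactSpace K] {E : Type*} [NormedAddCommGroup E]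
    (s : ℝ) (η : ℝ≥0∞) (R : ℝ) : Set C(K, E) :=
  {f | ∀ y ∈ closedBall (0 : E) R, ∃ U : ℕ → Set K, (∀ i, IsOpen (U i)) ∧ f ⁻¹' {y} ⊆ ⋃ i, U i ∧
    ∑' i, ediam (U i) ^ s ≤ η}

theorem isOpen_smallContent {K : Type*} [MetricSpace K] [CompactSpace K] {E : Type*}
    [NormedAddCommGroup E] [ProperSpace E] (s : ℝ) (η : ℝ≥0∞) (R : ℝ) :
    IsOpen (SmallContent s η R : Set C(K, E)) := by
  rw [isOpen_iff_mem_nhds]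
  intro f hf
  refine (isCompact_closedBall (0 : E) R).eventually_forall_of_forall_eventually fun y hy => ?_
  obtain ⟨U, hU, hfU, hUs⟩ := hf y hy
  have hcl : IsCompact (⋃ i, U i)ᶜ := (isOpen_iUnion hU).isClosed_compl.isCompact
  have h1 : ∀ᶠ z : C(K, E) × E in 𝓝 (f, y), ∀ x ∈ (⋃ i, U i)ᶜ, z.1 x ≠ z.2 := by
    refine hcl.eventually_forall_of_forall_eventually fun x hx => ?_
    have hne : f x ≠ y := fun h => hx (hfU h)
    have hc : Continuous fun w : (C(K, E) × E) × K => w.1.1 w.2 :=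
      continuous_eval.comp (continuous_fst.fst.prodMk continuous_snd)
    exact (isOpen_ne_fun hc continuous_fst.snd).mem_nhds hne
  filter_upwards [h1] with z hz
  exact ⟨U, hU, fun x hx => by_contra fun hxU => hz x hxU hx, hUs⟩

open MeasureTheory MeasureTheory.Measure in
theorem dense_smallContent {m n : ℕ} (hmn : n ≤ m) {s : ℝ} (hs : ((m - n : ℕ) : ℝ) < s) {η : ℝ≥0∞}
    (hη : 0 < η) (R : ℝ) : Dense (SmallContent s η R : Set C(Cube m, Fin n → ℝ)) := by
  refine Metric.dense_iff.2 fun f ε hε => ?_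
  obtain ⟨g, L, hL, hgf⟩ := exists_lipschitzWith_dist_le f (ε := ε / 4) (by positivity)
  obtain ⟨M, hM⟩ := exists_nat_gt (L / ε : ℝ)
  have hM0 : 0 < M := by
    have : (0 : ℝ) < M := lt_of_le_of_lt (by positivity) hM
    exact_mod_cast this
  have hLr : (L : ℝ) < 4 * M * (ε / 4) := by
    rw [div_lt_iff₀ hε] at hM
    linarith
  refine ⟨zigzag hmn g (ε / 4) M, ?_, fun y _ => ?_⟩
  · have h1 := dist_triangle (zigzag hmn g (ε / 4) M) g f
    have h2 := dist_zigzag_le hM0 hmn g (r := ε / 4) (by positivity)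
    rw [mem_ball]
    linarith
  · refine exists_isOpen_cover_of_hausdorffMeasure_eq_zero (lt_of_le_of_lt (by positivity) hs) ?_ hη
    have hs0 : 0 ≤ s := (lt_of_le_of_lt (by positivity) hs).le
    lift s to ℝ≥0 using hs0
    refine hausdorffMeasure_of_dimH_lt ((dimH_zigzag_fiber_le hM0 hL hLr y).trans_lt ?_)
    exact_mod_cast hs

open MeasureTheory MeasureTheory.Measure in
theorem eventually_residual_dimH_fiber_le {m n : ℕ} (hmn : n ≤ m) :
    ∀ᶠ f : C(Cube m, Fin n → ℝ) in residual C(Cube m, Fin n → ℝ),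
      ∀ y, dimH (f ⁻¹' {y}) ≤ ((m - n : ℕ) : ℝ≥0∞) := by
  have h : ∀ p : ℕ × ℕ × ℕ, ∀ᶠ f : C(Cube m, Fin n → ℝ) in residual C(Cube m, Fin n → ℝ),
      f ∈ SmallContent ((m - n : ℕ) + ((p.1 : ℝ) + 1)⁻¹) ((p.2.1 : ℝ≥0∞) + 1)⁻¹ (p.2.2 : ℝ) :=
    fun p => residual_of_dense_open (isOpen_smallContent _ _ _)
      (dense_smallContent hmn (by simp; positivity) (by simp) _)
  filter_upwards [eventually_countable_forall.2 h] with f hf y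
  obtain ⟨R, hR⟩ := exists_nat_ge ‖y‖
  generalize m - n = d at hf ⊢
  have h1 : ∀ q : ℕ, dimH (f ⁻¹' {y}) ≤ ((d : ℝ≥0) + ((q : ℝ≥0) + 1)⁻¹ : ℝ≥0) := by
    intro q
    refine dimH_le_of_hausdorffMeasure_ne_top ?_
    rw [hausdorffMeasure_eq_zero_of_forall_cover (by positivity)]
    · simp
    · intro k
      obtain ⟨U, -, hU, hUs⟩ := hf (q, k, R) y (by simpa using hR)
      refine ⟨U, hU, ?_⟩
      simpa using hUs
  have hlim : Tendsto (fun q : ℕ => ((d : ℝ≥0) + ((q : ℝ≥0) + 1)⁻¹ : ℝ≥0)) atTop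
      (𝓝 (d : ℝ≥0)) := by
    have h2 := (tendsto_one_div_add_atTop_nhds_zero_nat (𝕜 := ℝ≥0)).const_add (d : ℝ≥0)
    simpa using h2
  have := ge_of_tendsto' ((ENNReal.tendsto_coe.2 hlim)) h1
  simpa using this

/-- The cell with index `k₀` contains many small, well separated cells whose images are
neighborhoods of `y`. -/
def RichlyPacked {m n M₀ : ℕ} (f : C(Cube m, Fin n → ℝ)) (y : Fin n → ℝ)
    (k₀ : Fin m → Fin (2 * M₀)) (N : ℕ) : Prop :=
  ∃ M : ℕ, 0 < M ∧ (2 * M : ℝ)⁻¹ ≤ ((N : ℝ) + 1)⁻¹ ∧ ∃ T : Finset (Fin m → Fin (2 * M)),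
    (∀ k ∈ T, cellSet k ⊆ cellSet k₀ ∧ y ∈ interior (f '' cellSet k)) ∧
    (∀ k ∈ T, ∀ k' ∈ T, k ≠ k' → ∀ x ∈ cellSet k, ∀ x' ∈ cellSet k',
      3 * (2 * M : ℝ)⁻¹ ≤ dist x x') ∧
    (N : ℝ) ≤ T.card * (2 * M : ℝ)⁻¹ ^ ((m : ℝ) - ((N : ℝ) + 1)⁻¹)

theorem nearAffine_zigzag_cell {m n M : ℕ} (hM : 0 < M) {hmn : n ≤ m}
    {f f' : C(Cube m, Fin n → ℝ)} {r : ℝ} {y : Fin n → ℝ} (k : Fin m → Fin (2 * M))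
    (hf : ∀ x ∈ cellSet k, dist (f x) y ≤ r / 8) (hf' : dist f' (zigzag hmn f r M) ≤ r / 8) :
    NearAffine hmn r (r / 4) y (f' ∘ cell hM k) := by
  intro u i
  have h1 := (dist_le_pi_dist _ _ i).trans
    ((ContinuousMap.dist_apply_le_dist (cell hM k u)).trans hf')
  have h2 := (dist_le_pi_dist _ _ i).trans
    (hf (cell hM k u) (by rw [← range_cell hM]; exact ⟨u, rfl⟩))
  rw [zigzag_cell, Real.dist_eq] at h1
  rw [Real.dist_eq] at h2
  have h3 := abs_le.1 h1
  have h4 := abs_le.1 h2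
  rw [Function.comp_apply, abs_le]
  constructor <;> linarith [h3.1, h3.2, h4.1, h4.2]

theorem richlyPacked_of_dist_zigzag_le {m n M : ℕ} (hM : 0 < M) {hmn : n ≤ m}
    {f f' : C(Cube m, Fin n → ℝ)} {r : ℝ} (hr : 0 < r) {y : Fin n → ℝ} (k : Fin m → Fin (2 * M))
    {N P : ℕ} (hP : 0 < P) (hMN : (2 * M : ℝ)⁻¹ ≤ ((N : ℝ) + 1)⁻¹)
    (hPN : (N : ℝ) ≤ (P : ℝ) ^ m *
      (2 * (M * (4 * P) : ℕ) : ℝ)⁻¹ ^ ((m : ℝ) - ((N : ℝ) + 1)⁻¹))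
    (hf : ∀ x ∈ cellSet k, dist (f x) y ≤ r / 8)
    (hf' : dist f' (zigzag hmn f r (M * (4 * P))) ≤ r / 8) :
    RichlyPacked f' y k N ∧ ¬ indBelow (m - n) ↥(f' ⁻¹' {y}) ∧
      ((m - n : ℕ) : ℝ≥0∞) ≤ dimH (f' ⁻¹' {y}) := by
  classical
  have hM2 : 0 < M * (4 * P) := by positivity
  let I : (Fin m → Fin P) → Fin m → Fin (2 * (M * (4 * P))) :=
    fun b => subIndex k fun j => (⟨4 * b j, by omega⟩ : Fin (4 * P))
  have hI : Function.Injective I := by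
    intro b b' h
    ext j
    have h1 := congrArg Fin.val (congrFun h j)
    simp only [I, subIndex] at h1
    omega
  have hIk : ∀ b, cellSet (I b) ⊆ cellSet k := fun b => cellSet_subIndex_subset k _
  have key : ∀ b, y ∈ interior (f' '' cellSet (I b)) ∧ ¬ indBelow (m - n) ↥(f' ⁻¹' {y}) ∧
      ((m - n : ℕ) : ℝ≥0∞) ≤ dimH (f' ⁻¹' {y}) := by
    intro b
    rw [← range_cell hM2]
    exact NearAffine.fiber (continuous_cell hM2 _) (antilipschitzWith_cell hM2 _)
      (nearAffine_zigzag_cell hM2 (I b) (fun x hx => hf x (hIk b hx)) hf') (by linarith)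
  refine ⟨⟨M * (4 * P), hM2, le_trans ?_ hMN, Finset.univ.image I, ?_, ?_, ?_⟩,
    (key fun _ => ⟨0, hP⟩).2⟩
  · have h1 : (M : ℝ) ≤ (M * (4 * P) : ℕ) := by exact_mod_cast Nat.le_mul_of_pos_right M (by omega)
    have hM' : (0 : ℝ) < M := by exact_mod_cast hM
    gcongr
  · intro k' hk'
    obtain ⟨b, -, rfl⟩ := Finset.mem_image.1 hk'
    exact ⟨hIk b, (key b).1⟩
  · intro k₁ hk₁ k₂ hk₂ hne x hx x' hx'
    obtain ⟨b, -, rfl⟩ := Finset.mem_image.1 hk₁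
    obtain ⟨b', -, rfl⟩ := Finset.mem_image.1 hk₂
    exact three_mul_le_dist_of_ne k (b := b) (b' := b') (fun h => hne (by rw [h])) hx hx'
  · rw [Finset.card_image_of_injective _ hI, Finset.card_univ, Fintype.card_pi]
    simpa using hPN

theorem RichlyPacked.mono {m n M M' : ℕ} {f : C(Cube m, Fin n → ℝ)} {y : Fin n → ℝ}
    {k : Fin m → Fin (2 * M)} {k' : Fin m → Fin (2 * M')} {N : ℕ} (h : RichlyPacked f y k N)
    (hk : cellSet k ⊆ cellSet k') : RichlyPacked f y k' N := by
  obtain ⟨L, hL, hLN, T, hT, h1⟩ := h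
  exact ⟨L, hL, hLN, T, fun l hl => ⟨(hT l hl).1.trans hk, (hT l hl).2⟩, h1⟩

theorem exists_le_pow_mul_rpow {m M N : ℕ} (hM : 0 < M) : ∃ P : ℕ, 0 < P ∧
    (N : ℝ) ≤ (P : ℝ) ^ m * (2 * (M * (4 * P) : ℕ) : ℝ)⁻¹ ^ ((m : ℝ) - ((N : ℝ) + 1)⁻¹) := by
  have hM' : (0 : ℝ) < M := by exact_mod_cast hM
  set α : ℝ := ((N : ℝ) + 1)⁻¹ with hα
  have hα0 : 0 < α := by positivity
  have h1 : Tendsto (fun P : ℕ => ((8 * M : ℝ)⁻¹) ^ ((m : ℝ) - α) * (P : ℝ) ^ α) atTop atTop :=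
    ((tendsto_rpow_atTop hα0).comp tendsto_natCast_atTop_atTop).const_mul_atTop (by positivity)
  obtain ⟨P, hP, hP0⟩ := ((h1.eventually_ge_atTop (N : ℝ)).and (eventually_gt_atTop 0)).exists
  refine ⟨P, hP0, hP.trans_eq ?_⟩
  have hP' : (0 : ℝ) < P := by exact_mod_cast hP0
  have h2 : (2 * (M * (4 * P) : ℕ) : ℝ)⁻¹ = (8 * M : ℝ)⁻¹ * (P : ℝ)⁻¹ := by
    push_cast
    rw [← mul_inv]
    congr 1
    ring
  rw [h2, Real.mul_rpow (by positivity) (by positivity), Real.inv_rpow hP'.le,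
    ← Real.rpow_neg hP'.le, mul_left_comm, ← Real.rpow_natCast, ← Real.rpow_add hP']
  congr 2
  ring

theorem exists_forall_dist_le_richlyPacked {m n M₀ : ℕ} (hmn : n ≤ m) (hM₀ : 0 < M₀)
    (f : C(Cube m, Fin n → ℝ)) (k₀ : Fin m → Fin (2 * M₀)) (N : ℕ) {r : ℝ} (hr : 0 < r) :
    ∃ g : C(Cube m, Fin n → ℝ), dist g f ≤ r ∧ ∀ f', dist f' g ≤ r / 8 → ∀ y ∈ f '' cellSet k₀,
      RichlyPacked f' y k₀ N ∧ ¬ indBelow (m - n) ↥(f' ⁻¹' {y}) ∧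
      ((m - n : ℕ) : ℝ≥0∞) ≤ dimH (f' ⁻¹' {y}) := by
  obtain ⟨ρ, hρ, hfρ⟩ := Metric.uniformContinuous_iff.1
    (CompactSpace.uniformContinuous_of_continuous f.continuous) (r / 8) (by positivity)
  obtain ⟨P₁, hP₁⟩ := exists_nat_gt (max ρ⁻¹ (N + 1))
  have hP₁ρ := (le_max_left _ _).trans_lt hP₁
  have hP₁N := (le_max_right _ _).trans_lt hP₁
  have hP₁0 : 0 < P₁ := by
    have : (0 : ℝ) < P₁ := lt_trans (by positivity) hP₁N
    exact_mod_cast this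
  have hP₁' : (0 : ℝ) < P₁ := by exact_mod_cast hP₁0
  have hM : 0 < M₀ * P₁ := by positivity
  have hPM : (P₁ : ℝ) ≤ 2 * (M₀ * P₁ : ℕ) := by
    have : P₁ ≤ M₀ * P₁ := Nat.le_mul_of_pos_left P₁ hM₀
    exact_mod_cast (by omega : P₁ ≤ 2 * (M₀ * P₁))
  have h1 : (2 * (M₀ * P₁ : ℕ) : ℝ)⁻¹ < ρ := by
    refine (inv_anti₀ hP₁' hPM).trans_lt ?_
    rwa [inv_lt_comm₀ hP₁' hρ]
  have h2 : (2 * (M₀ * P₁ : ℕ) : ℝ)⁻¹ ≤ ((N : ℝ) + 1)⁻¹ :=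
    inv_anti₀ (by positivity) (hP₁N.le.trans hPM)
  obtain ⟨P, hP, hPN⟩ := exists_le_pow_mul_rpow (m := m) (N := N) hM
  refine ⟨zigzag hmn f r (M₀ * P₁ * (4 * P)), dist_zigzag_le (by positivity) hmn f hr.le, ?_⟩
  rintro f' hf' _ ⟨x, hx, rfl⟩
  obtain ⟨a, ha⟩ := exists_mem_cellSet_subIndex hM₀ hP₁0 hx
  obtain ⟨h3, h4⟩ := richlyPacked_of_dist_zigzag_le hM hr (subIndex k₀ a) hP h2 hPN
    (fun z hz => (hfρ ((dist_le_of_mem_cellSet hz ha).trans_lt h1)).le) hf'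
  exact ⟨h3.mono (cellSet_subIndex_subset k₀ a), h4⟩

theorem eventually_residual_forall_mem_closedBall {m n M₀ : ℕ} (hmn : n ≤ m) (hM₀ : 0 < M₀)
    (k₀ : Fin m → Fin (2 * M₀)) (N : ℕ) (b : Fin n → ℝ) (β : ℝ) :
    ∀ᶠ f : C(Cube m, Fin n → ℝ) in residual C(Cube m, Fin n → ℝ),
      closedBall b β ⊆ f '' cellSet k₀ → ∀ y ∈ closedBall b β,
        RichlyPacked f y k₀ N ∧ ¬ indBelow (m - n) ↥(f ⁻¹' {y}) ∧
        ((m - n : ℕ) : ℝ≥0∞) ≤ dimH (f ⁻¹' {y}) := by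
  set W : Set C(Cube m, Fin n → ℝ) := {f | closedBall b β ⊆ f '' cellSet k₀ →
    ∀ y ∈ closedBall b β, RichlyPacked f y k₀ N ∧ ¬ indBelow (m - n) ↥(f ⁻¹' {y}) ∧
        ((m - n : ℕ) : ℝ≥0∞) ≤ dimH (f ⁻¹' {y})}
  suffices h : Dense (interior W) from
    mem_of_superset (residual_of_dense_open isOpen_interior h) interior_subset
  refine Metric.dense_iff.2 fun f ε hε => ?_
  by_cases hf : closedBall b β ⊆ f '' cellSet k₀
  · obtain ⟨g, hgf, hg⟩ := exists_forall_dist_le_richlyPacked hmn hM₀ f k₀ N (half_pos hε)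
    refine ⟨g, mem_ball.2 (by linarith), mem_interior.2 ⟨ball g (ε / 2 / 8), fun f' hf' _ y hy => ?_,
      isOpen_ball, mem_ball_self (by positivity)⟩⟩
    exact hg f' (mem_ball.1 hf').le y (hf hy)
  · refine ⟨f, mem_ball_self hε, ?_⟩
    obtain ⟨y, hy, hyf⟩ := not_subset.1 hf
    rw [mem_interior_iff_mem_nhds]
    have h1 : ∀ᶠ f' : C(Cube m, Fin n → ℝ) in 𝓝 f, ∀ x ∈ cellSet k₀, f' x ≠ y := by
      refine (isCompact_cellSet k₀).eventually_forall_of_forall_eventually fun x hx => ?_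
      exact (isOpen_ne_fun continuous_eval continuous_const).mem_nhds
        (fun h => hyf ⟨x, hx, h⟩)
    filter_upwards [h1] with f' hf' hsub
    obtain ⟨x, hx, hxy⟩ := hsub hy
    exact absurd hxy (hf' x hx)

theorem exists_closedBall_denseSeq_subset {n : ℕ} {A : Set (Fin n → ℝ)} {y : Fin n → ℝ}
    (hy : y ∈ interior A) : ∃ q l : ℕ,
      closedBall (denseSeq (Fin n → ℝ) q) ((l : ℝ) + 1)⁻¹ ⊆ A ∧
      y ∈ closedBall (denseSeq (Fin n → ℝ) q) ((l : ℝ) + 1)⁻¹ := by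
  obtain ⟨ε, hε, hεy⟩ := Metric.isOpen_iff.1 isOpen_interior y hy
  obtain ⟨l, hl⟩ := exists_nat_one_div_lt (half_pos hε)
  rw [one_div] at hl
  obtain ⟨q, hq⟩ := (denseRange_denseSeq (Fin n → ℝ)).exists_dist_lt y
    (by positivity : (0 : ℝ) < ((l : ℝ) + 1)⁻¹)
  refine ⟨q, l, fun z hz => interior_subset (hεy ?_), mem_closedBall.2 hq.le⟩
  rw [mem_closedBall] at hz
  rw [mem_ball]
  have := dist_triangle z (denseSeq (Fin n → ℝ) q) y
  rw [dist_comm y] at hq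
  linarith

/-- If the image of a cell is a neighborhood of `y` then the cell is richly packed at all scales,
and the fiber over `y` is large. -/
theorem eventually_residual_richlyPacked {m n : ℕ} (hmn : n ≤ m) :
    ∀ᶠ f : C(Cube m, Fin n → ℝ) in residual C(Cube m, Fin n → ℝ),
      ∀ (M₀ : ℕ) (k₀ : Fin m → Fin (2 * M₀)) (N : ℕ) (y : Fin n → ℝ), 0 < M₀ →
        y ∈ interior (f '' cellSet k₀) →
        RichlyPacked f y k₀ N ∧ ¬ indBelow (m - n) ↥(f ⁻¹' {y}) ∧
        ((m - n : ℕ) : ℝ≥0∞) ≤ dimH (f ⁻¹' {y}) := by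
  have h : ∀ p : (Σ M : {M : ℕ // 0 < M}, Fin m → Fin (2 * M)) × ℕ × ℕ × ℕ,
      ∀ᶠ f : C(Cube m, Fin n → ℝ) in residual C(Cube m, Fin n → ℝ),
      closedBall (denseSeq (Fin n → ℝ) p.2.2.1) ((p.2.2.2 : ℝ) + 1)⁻¹ ⊆ f '' cellSet p.1.2 →
        ∀ y ∈ closedBall (denseSeq (Fin n → ℝ) p.2.2.1) ((p.2.2.2 : ℝ) + 1)⁻¹,
        RichlyPacked f y p.1.2 p.2.1 ∧ ¬ indBelow (m - n) ↥(f ⁻¹' {y}) ∧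
        ((m - n : ℕ) : ℝ≥0∞) ≤ dimH (f ⁻¹' {y}) :=
    fun p => eventually_residual_forall_mem_closedBall hmn p.1.1.2 p.1.2 _ _ _
  filter_upwards [eventually_countable_forall.2 h] with f hf M₀ k₀ N y hM₀ hy
  obtain ⟨q, l, hsub, hmem⟩ := exists_closedBall_denseSeq_subset hy
  exact hf (⟨⟨M₀, hM₀⟩, k₀⟩, N, q, l) hsub y hmem

/-- The points of the cube near which `f` covers a neighborhood of `y` by the image of a cell. -/
def robustFiber {m n : ℕ} (f : C(Cube m, Fin n → ℝ)) (y : Fin n → ℝ) : Set (Cube m) :=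
  {x | ∀ U, IsOpen U → x ∈ U → ∃ M : ℕ, 0 < M ∧ ∃ k : Fin m → Fin (2 * M),
    cellSet k ⊆ U ∧ y ∈ interior (f '' cellSet k)}

theorem isClosed_robustFiber {m n : ℕ} (f : C(Cube m, Fin n → ℝ)) (y : Fin n → ℝ) :
    IsClosed (robustFiber f y) := by
  refine isClosed_of_closure_subset fun x hx U hU hxU => ?_
  obtain ⟨z, hzU, hz⟩ := mem_closure_iff.1 hx U hU hxU
  exact hz U hU hzU

theorem robustFiber_subset {m n : ℕ} (f : C(Cube m, Fin n → ℝ)) (y : Fin n → ℝ) :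
    robustFiber f y ⊆ f ⁻¹' {y} := by
  intro x hx
  by_contra hne
  obtain ⟨M, -, k, hk, hy⟩ := hx (f ⁻¹' {y})ᶜ
    (isClosed_singleton.preimage f.continuous).isOpen_compl hne
  obtain ⟨z, hz, hzy⟩ := interior_subset hy
  exact hk hz hzy

theorem exists_mem_robustFiber {m n M₀ : ℕ} {f : C(Cube m, Fin n → ℝ)} {y : Fin n → ℝ}
    (hf : ∀ (M : ℕ) (k : Fin m → Fin (2 * M)) (N : ℕ), 0 < M → y ∈ interior (f '' cellSet k) →
      RichlyPacked f y k N) (hM₀ : 0 < M₀) (k₀ : Fin m → Fin (2 * M₀))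
    (hy : y ∈ interior (f '' cellSet k₀)) : ∃ x ∈ robustFiber f y, x ∈ cellSet k₀ := by
  let S := {p : Σ M : ℕ, Fin m → Fin (2 * M) // 0 < p.1 ∧ y ∈ interior (f '' cellSet p.2)}
  have hnext : ∀ (N : ℕ) (p : S), ∃ q : S, cellSet q.1.2 ⊆ cellSet p.1.2 ∧
      (2 * q.1.1 : ℝ)⁻¹ ≤ ((N : ℝ) + 1)⁻¹ := by
    rintro N ⟨⟨M, k⟩, hM, hk⟩
    obtain ⟨M', hM', hN, T, hT, -, hcard⟩ := hf M k (N + 1) hM hk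
    have hTne : T.Nonempty := by
      by_contra hne
      rw [Finset.not_nonempty_iff_eq_empty.1 hne, Finset.card_empty, Nat.cast_zero,
        zero_mul] at hcard
      push_cast at hcard
      have : (0 : ℝ) ≤ N := by positivity
      linarith
    obtain ⟨k', hk'⟩ := hTne
    refine ⟨⟨⟨M', k'⟩, hM', (hT k' hk').2⟩, (hT k' hk').1, hN.trans ?_⟩
    push_cast
    exact inv_anti₀ (by positivity) (by linarith)
  choose next hnext1 hnext2 using hnext
  let q : ℕ → S := fun i => Nat.rec ⟨⟨M₀, k₀⟩, hM₀, hy⟩ (fun j p => next j p) i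
  have hq : ∀ i, q (i + 1) = next i (q i) := fun i => rfl
  obtain ⟨x, hx⟩ := IsCompact.nonempty_iInter_of_sequence_nonempty_isCompact_isClosed
    (fun i => cellSet (q i).1.2) (fun i => by rw [hq]; exact hnext1 _ _)
    (fun i => by
      obtain ⟨z, hz, -⟩ := interior_subset (q i).2.2
      exact ⟨z, hz⟩)
    (isCompact_cellSet _) (fun i => (isCompact_cellSet _).isClosed)
  rw [mem_iInter] at hx
  refine ⟨x, fun U hU hxU => ?_, hx 0⟩
  obtain ⟨ε, hε, hεU⟩ := Metric.isOpen_iff.1 hU x hxU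
  obtain ⟨N, hN⟩ := exists_nat_one_div_lt hε
  rw [one_div] at hN
  refine ⟨(q (N + 1)).1.1, (q (N + 1)).2.1, (q (N + 1)).1.2, fun z hz => hεU ?_, (q (N + 1)).2.2⟩
  refine mem_ball.2 ((dist_le_of_mem_cellSet hz (hx (N + 1))).trans_lt ?_)
  rw [hq]
  exact (hnext2 _ _).trans_lt hN

theorem packPre0_eq_top {m n M₀ : ℕ} {f : C(Cube m, Fin n → ℝ)} {y : Fin n → ℝ}
    (hf : ∀ (M : ℕ) (k : Fin m → Fin (2 * M)) (N : ℕ), 0 < M → y ∈ interior (f '' cellSet k) →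
      RichlyPacked f y k N) (hM₀ : 0 < M₀) (k₀ : Fin m → Fin (2 * M₀))
    (hy : y ∈ interior (f '' cellSet k₀)) {c : Set (Cube m)}
    (hc : ∀ x ∈ robustFiber f y, x ∈ cellSet k₀ → x ∈ closure c) {s : ℝ≥0} (hs : s < m) :
    packPre0 (fun r => r ^ (s : ℝ)) c = ∞ := by
  refine iInf₂_eq_top.2 fun δ hδ => ENNReal.eq_top_of_forall_nnreal_le fun B => ?_
  have hs' : (s : ℝ) < m := by exact_mod_cast hs
  obtain ⟨N, hN⟩ := exists_nat_gt (max (B : ℝ) (max (δ : ℝ)⁻¹ ((m : ℝ) - s)⁻¹))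
  have hNB : (B : ℝ) < N := (le_max_left _ _).trans_lt hN
  have hNδ : (δ : ℝ)⁻¹ < N := (le_max_left _ _).trans_lt ((le_max_right _ _).trans_lt hN)
  have hNs : ((m : ℝ) - s)⁻¹ < N := (le_max_right _ _).trans_lt ((le_max_right _ _).trans_lt hN)
  obtain ⟨M, hM, hMN, T, hT, hsep, hcard⟩ := hf M₀ k₀ N hM₀ hy
  have hM' : (0 : ℝ) < M := by exact_mod_cast hM
  obtain ⟨w, hw⟩ : ∃ w : ℝ≥0, (w : ℝ) = (2 * M : ℝ)⁻¹ := ⟨⟨_, by positivity⟩, rfl⟩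
  rw [← hw] at hMN hcard hsep
  have hw0 : (0 : ℝ) < w := by rw [hw]; positivity
  have hz : ∀ k : Fin m → Fin (2 * M), ∃ z : Cube m, k ∈ T →
      z ∈ c ∧ ∃ x ∈ cellSet k, dist x z < w / 3 := by
    intro k
    by_cases hk : k ∈ T
    · obtain ⟨x, hx, hxk⟩ := exists_mem_robustFiber hf hM k (hT k hk).2
      obtain ⟨z, hzc, hz⟩ := Metric.mem_closure_iff.1 (hc x hx ((hT k hk).1 hxk)) (w / 3)
        (by positivity)
      exact ⟨z, fun _ => ⟨hzc, x, hxk, hz⟩⟩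
    · obtain ⟨z, -, -⟩ := interior_subset hy
      exact ⟨z, fun h => absurd h hk⟩
  choose z hz using hz
  have hdist : ∀ k ∈ T, ∀ k' ∈ T, k ≠ k' → 2 * (w : ℝ) < dist (z k) (z k') := by
    intro k hk k' hk' hne
    obtain ⟨-, x, hx, hxz⟩ := hz k hk
    obtain ⟨-, x', hx', hxz'⟩ := hz k' hk'
    have h1 := hsep k hk k' hk' hne x hx x' hx'
    have h2 := dist_triangle4 x (z k) (z k') x'
    rw [dist_comm (z k') x'] at h2
    linarith
  have hinj : InjOn (fun k => (z k, w)) (T : Set (Fin m → Fin (2 * M))) := by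
    intro k hk k' hk' h
    by_contra hne
    have h1 := hdist k hk k' hk' hne
    have h2 : z k = z k' := (Prod.ext_iff.1 h).1
    rw [h2, dist_self] at h1
    linarith
  have hpack : IsPacking c δ ((fun k => (z k, w)) '' (T : Set (Fin m → Fin (2 * M)))) := by
    refine ⟨(T.finite_toSet.image _).countable, ?_, ?_⟩
    · rintro _ ⟨k, hk, rfl⟩
      refine ⟨(hz k hk).1, ?_⟩
      rw [← NNReal.coe_le_coe]
      refine hMN.trans ?_
      rw [inv_le_comm₀ (by positivity) (by exact_mod_cast hδ)]
      linarith
    · rintro _ ⟨k, hk, rfl⟩ _ ⟨k', hk', rfl⟩ hne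
      refine closedBall_disjoint_closedBall ?_
      have := hdist k hk k' hk' (fun h => hne (by rw [h]))
      simp only
      linarith
  have hsum : ∑' p : ((fun k => (z k, w)) '' (T : Set (Fin m → Fin (2 * M)))),
      (((p.1.2 : ℝ≥0) ^ (s : ℝ) : ℝ≥0) : ℝ≥0∞) = ((T.card * w ^ (s : ℝ) : ℝ≥0) : ℝ≥0∞) := by
    rw [tsum_image (fun p : Cube m × ℝ≥0 => (((p.2 : ℝ≥0) ^ (s : ℝ) : ℝ≥0) : ℝ≥0∞)) hinj]
    simp only
    rw [Finset.tsum_subtype' T (fun _ => ((w ^ (s : ℝ) : ℝ≥0) : ℝ≥0∞)), Finset.sum_const,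
      nsmul_eq_mul]
    push_cast
    rfl
  refine le_trans ?_ (le_iSup₂_of_le _ hpack hsum.ge)
  rw [ENNReal.coe_le_coe, ← NNReal.coe_le_coe]
  push_cast
  refine hNB.le.trans (hcard.trans ?_)
  refine mul_le_mul_of_nonneg_left ?_ (Nat.cast_nonneg _)
  have h1 : ((N : ℝ) + 1)⁻¹ ≤ 1 :=
    inv_le_one_of_one_le₀ (by linarith [(Nat.cast_nonneg N : (0 : ℝ) ≤ N)])
  refine Real.rpow_le_rpow_of_exponent_ge hw0 (hMN.trans h1) ?_
  have h2 : ((N : ℝ) + 1)⁻¹ ≤ (m : ℝ) - s := by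
    rw [inv_le_comm₀ (by positivity) (by linarith)]
    linarith
  linarith

theorem packMeasure_fiber_eq_top {m n M₀ : ℕ} {f : C(Cube m, Fin n → ℝ)} {y : Fin n → ℝ}
    (hf : ∀ (M : ℕ) (k : Fin m → Fin (2 * M)) (N : ℕ), 0 < M → y ∈ interior (f '' cellSet k) →
      RichlyPacked f y k N) (hM₀ : 0 < M₀) (k₀ : Fin m → Fin (2 * M₀))
    (hy : y ∈ interior (f '' cellSet k₀)) {s : ℝ≥0} (hs : s < m) :
    packMeasure (fun r => r ^ (s : ℝ)) (f ⁻¹' {y}) = ∞ := by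
  refine iInf₂_eq_top.2 fun c hc => ?_
  obtain ⟨x₀, hx₀, -⟩ := exists_mem_robustFiber hf hM₀ k₀ hy
  have : Nonempty (robustFiber f y) := ⟨⟨x₀, hx₀⟩⟩
  have : CompactSpace (robustFiber f y) :=
    isCompact_iff_compactSpace.1 (isClosed_robustFiber f y).isCompact
  obtain ⟨i, x, hx⟩ := nonempty_interior_of_iUnion_of_closed
    (f := fun i => ((↑) : robustFiber f y → Cube m) ⁻¹' closure (c i))
    (fun i => isClosed_closure.preimage continuous_subtype_val) (by
      refine eq_univ_of_forall fun x => ?_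
      have h1 := robustFiber_subset f y x.2
      rw [hc] at h1
      obtain ⟨i, hi⟩ := mem_iUnion.1 h1
      exact mem_iUnion.2 ⟨i, subset_closure hi⟩)
  obtain ⟨V, hV, hVo, hxV⟩ := mem_interior.1 hx
  obtain ⟨U, hU, rfl⟩ := isOpen_induced_iff.1 hVo
  obtain ⟨M, hM, k, hkU, hk⟩ := x.2 U hU hxV
  have h1 : packPre0 (fun r => r ^ (s : ℝ)) (c i) = ∞ :=
    packPre0_eq_top hf hM k hk (fun z hz hzk => hV (a := ⟨z, hz⟩) (hkU hzk)) hs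
  exact ENNReal.tsum_eq_top_of_eq_top ⟨i, h1⟩

open MeasureTheory in
theorem tsum_rpow_le_one_of_isPacking {m : ℕ} {s : ℝ} (hs : (m : ℝ) ≤ s) (hs0 : 0 < s)
    {A : Set (Cube m)} {t : Set (Cube m × ℝ≥0)} (ht : IsPacking A 1 t) :
    ∑' p : t, ((p.1.2 ^ s : ℝ≥0) : ℝ≥0∞) ≤ 1 := by
  obtain ⟨htc, htr, htd⟩ := ht
  have := htc.to_subtype
  let a : Cube m × ℝ≥0 → Fin m → ℝ := fun p j => max (p.1.1 j - p.2) 0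
  let b : Cube m × ℝ≥0 → Fin m → ℝ := fun p j => min (p.1.1 j + p.2) 1
  have hab : ∀ p : Cube m × ℝ≥0, ∀ x : Fin m → ℝ, x ∈ Icc (a p) (b p) →
      ∃ hx : x ∈ Icc (0 : Fin m → ℝ) 1, (⟨x, hx⟩ : Cube m) ∈ closedBall p.1 p.2 := by
    intro p x hx
    have h1 : ∀ j, p.1.1 j - p.2 ≤ x j ∧ 0 ≤ x j := fun j => max_le_iff.1 (hx.1 j)
    have h2 : ∀ j, x j ≤ p.1.1 j + p.2 ∧ x j ≤ 1 := fun j => le_min_iff.1 (hx.2 j)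
    refine ⟨⟨fun j => (h1 j).2, fun j => (h2 j).2⟩, mem_closedBall.2 ?_⟩
    refine (dist_pi_le_iff p.2.2).2 fun j => ?_
    change |x j - p.1.1 j| ≤ p.2
    rw [abs_le]
    exact ⟨by linarith [(h1 j).1], by linarith [(h2 j).1]⟩
  have hvol : ∀ p : t, ((p.1.2 ^ s : ℝ≥0) : ℝ≥0∞) ≤ volume (Icc (a p) (b p)) := by
    rintro ⟨p, hp⟩
    have hp1 : p.2 ≤ 1 := (htr p hp).2
    have hp1' : (p.2 : ℝ) ≤ 1 := by exact_mod_cast hp1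
    have hp0 : (0 : ℝ) ≤ p.2 := p.2.2
    rw [Real.volume_Icc_pi]
    have h1 : ∀ j, (p.2 : ℝ≥0∞) ≤ ENNReal.ofReal (b p j - a p j) := by
      intro j
      rw [← ENNReal.ofReal_coe_nnreal]
      refine ENNReal.ofReal_le_ofReal ?_
      have h2 := p.1.nonneg j
      have h3 := p.1.le_one j
      simp only [a, b]
      rcases max_cases (p.1.1 j - p.2) 0 with h | h <;>
        rcases min_cases (p.1.1 j + p.2) 1 with h' | h' <;> linarith [h.1, h'.1]
    calc ((p.2 ^ s : ℝ≥0) : ℝ≥0∞) ≤ ((p.2 ^ (m : ℝ) : ℝ≥0) : ℝ≥0∞) := by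
          rw [ENNReal.coe_le_coe, ← NNReal.coe_le_coe]
          push_cast
          rcases hp0.eq_or_lt with h | h
          · rw [← h, Real.zero_rpow hs0.ne']
            positivity
          · exact Real.rpow_le_rpow_of_exponent_ge h hp1' hs
      _ = ∏ _j : Fin m, (p.2 : ℝ≥0∞) := by
          rw [NNReal.rpow_natCast, Finset.prod_const, Finset.card_univ, Fintype.card_fin]
          push_cast
          rfl
      _ ≤ _ := Finset.prod_le_prod' fun j _ => h1 j
  calc ∑' p : t, ((p.1.2 ^ s : ℝ≥0) : ℝ≥0∞) ≤ ∑' p : t, volume (Icc (a p) (b p)) :=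
        ENNReal.tsum_le_tsum hvol
    _ = volume (⋃ p : t, Icc (a p) (b p)) := by
        refine (measure_iUnion ?_ fun p => measurableSet_Icc).symm
        intro p q hpq
        refine disjoint_left.2 fun x hx hx' => ?_
        obtain ⟨h1, h2⟩ := hab p x hx
        obtain ⟨h3, h4⟩ := hab q x hx'
        exact disjoint_left.1 (htd p.2 q.2 (fun h => hpq (Subtype.ext h))) h2 h4
    _ ≤ volume (Icc (0 : Fin m → ℝ) 1) := by
        refine measure_mono (iUnion_subset fun p x hx => ?_)
        exact (hab p x hx).1
    _ = 1 := by
        rw [Real.volume_Icc_pi]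
        simp

theorem packMeasure_lt_top {m : ℕ} {s : ℝ} (hs : (m : ℝ) ≤ s) (hs0 : 0 < s) (A : Set (Cube m)) :
    packMeasure (fun r => r ^ s) A < ∞ := by
  have h1 : ∀ A : Set (Cube m), packPre0 (fun r => r ^ s) A ≤ 1 := fun A =>
    (iInf₂_le (1 : ℝ≥0) one_pos).trans
      (iSup₂_le fun t ht => tsum_rpow_le_one_of_isPacking hs hs0 ht)
  have h2 : packPre0 (fun r => r ^ s) (∅ : Set (Cube m)) = 0 := by
    refine le_antisymm ((iInf₂_le (1 : ℝ≥0) one_pos).trans (iSup₂_le fun t ht => ?_)) zero_le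
    have : IsEmpty t := ⟨fun p => (ht.2.1 p p.2).1⟩
    simp
  refine lt_of_le_of_lt (iInf₂_le (fun i : ℕ => if i = 0 then A else ∅) ?_) ?_
  · ext x
    simp
  · rw [tsum_eq_single 0 (fun i hi => by simp [hi, h2])]
    exact (h1 _).trans_lt (by simp)

theorem pdim_fiber_eq {m n M₀ : ℕ} {f : C(Cube m, Fin n → ℝ)} {y : Fin n → ℝ}
    (hf : ∀ (M : ℕ) (k : Fin m → Fin (2 * M)) (N : ℕ), 0 < M → y ∈ interior (f '' cellSet k) →
      RichlyPacked f y k N) (hm : 0 < m) (hM₀ : 0 < M₀) (k₀ : Fin m → Fin (2 * M₀))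
    (hy : y ∈ interior (f '' cellSet k₀)) : pdim (f ⁻¹' {y}) = (m : EReal) := by
  have hne : f ⁻¹' {y} ≠ ∅ := by
    obtain ⟨x, hx, -⟩ := exists_mem_robustFiber hf hM₀ k₀ hy
    have h : (f ⁻¹' {y}).Nonempty := ⟨x, robustFiber_subset f y hx⟩
    exact h.ne_empty
  have hm' : (0 : EReal) < m := by exact_mod_cast hm
  rw [pdim, if_neg hne]
  refine le_antisymm (max_le hm'.le (iSup₂_le fun s hs => ?_)) (le_of_forall_lt fun c hc => ?_)
  · by_contra! hlt
    have h1 : ((m : ℝ) : EReal) < ((s : ℝ) : EReal) := by simpa using hlt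
    rw [EReal.coe_lt_coe_iff] at h1
    exact (packMeasure_lt_top h1.le (lt_of_le_of_lt (by positivity) h1) _).ne hs
  · obtain ⟨s, hs1, hs2⟩ := EReal.lt_iff_exists_real_btwn.1 (max_lt hc hm')
    have hs0 : (0 : ℝ) ≤ s := by
      have := ((le_max_right c 0).trans_lt hs1).le
      exact_mod_cast this
    lift s to ℝ≥0 using hs0
    have hs3 : s < m := by
      have : ((s : ℝ) : EReal) < ((m : ℝ) : EReal) := by simpa using hs2
      rw [EReal.coe_lt_coe_iff] at this
      exact_mod_cast this
    refine ((le_max_left c 0).trans_lt hs1).trans_le (le_max_of_le_right ?_)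
    exact le_iSup₂_of_le s (packMeasure_fiber_eq_top hf hM₀ k₀ hy hs3) le_rfl

theorem exists_forall_dist_le_mem_interior_cellSet {m n : ℕ} (hmn : n ≤ m)
    (f : C(Cube m, Fin n → ℝ)) {r : ℝ} (hr : 0 < r) :
    ∃ g : C(Cube m, Fin n → ℝ), dist g f ≤ r ∧ ∀ f', dist f' g ≤ r / 8 → ∀ y ∈ range f,
      ∃ M : ℕ, 0 < M ∧ ∃ k : Fin m → Fin (2 * M), y ∈ interior (f' '' cellSet k) := by
  obtain ⟨ρ, hρ, hfρ⟩ := Metric.uniformContinuous_iff.1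
    (CompactSpace.uniformContinuous_of_continuous f.continuous) (r / 8) (by positivity)
  obtain ⟨M, hMρ⟩ := exists_nat_gt ρ⁻¹
  have hM' : (0 : ℝ) < M := lt_trans (by positivity) hMρ
  have hM : 0 < M := by exact_mod_cast hM'
  have h1 : (2 * M : ℝ)⁻¹ < ρ := by
    rw [inv_lt_comm₀ (by positivity) hρ]
    linarith
  refine ⟨zigzag hmn f r M, dist_zigzag_le hM hmn f hr.le, ?_⟩
  rintro f' hf' _ ⟨x, rfl⟩
  obtain ⟨k, hk⟩ := exists_mem_cellSet hM x
  refine ⟨M, hM, k, ?_⟩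
  rw [← range_cell hM]
  exact (NearAffine.fiber (continuous_cell hM k) (antilipschitzWith_cell hM k)
    (nearAffine_zigzag_cell hM k (fun z hz =>
      (hfρ ((dist_le_of_mem_cellSet hz hk).trans_lt h1)).le) hf') (by linarith)).1

theorem eventually_residual_forall_mem_closedBall_cellSet {m n : ℕ} (hmn : n ≤ m)
    (b : Fin n → ℝ) (β : ℝ) :
    ∀ᶠ f : C(Cube m, Fin n → ℝ) in residual C(Cube m, Fin n → ℝ),
      closedBall b β ⊆ range f → ∀ y ∈ closedBall b β,
        ∃ M : ℕ, 0 < M ∧ ∃ k : Fin m → Fin (2 * M), y ∈ interior (f '' cellSet k) := by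
  set W : Set C(Cube m, Fin n → ℝ) := {f | closedBall b β ⊆ range f → ∀ y ∈ closedBall b β,
    ∃ M : ℕ, 0 < M ∧ ∃ k : Fin m → Fin (2 * M), y ∈ interior (f '' cellSet k)}
  suffices h : Dense (interior W) from
    mem_of_superset (residual_of_dense_open isOpen_interior h) interior_subset
  refine Metric.dense_iff.2 fun f ε hε => ?_
  by_cases hf : closedBall b β ⊆ range f
  · obtain ⟨g, hgf, hg⟩ := exists_forall_dist_le_mem_interior_cellSet hmn f (half_pos hε)
    refine ⟨g, mem_ball.2 (by linarith), mem_interior.2 ⟨ball g (ε / 2 / 8), fun f' hf' _ y hy => ?_,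
      isOpen_ball, mem_ball_self (by positivity)⟩⟩
    exact hg f' (mem_ball.1 hf').le y (hf hy)
  · refine ⟨f, mem_ball_self hε, ?_⟩
    obtain ⟨y, hy, hyf⟩ := not_subset.1 hf
    rw [mem_interior_iff_mem_nhds]
    have h1 : ∀ᶠ f' : C(Cube m, Fin n → ℝ) in 𝓝 f, ∀ x ∈ univ, f' x ≠ y := by
      refine isCompact_univ.eventually_forall_of_forall_eventually fun x _ => ?_
      exact (isOpen_ne_fun continuous_eval continuous_const).mem_nhds
        (fun h => hyf ⟨x, h⟩)
    filter_upwards [h1] with f' hf' hsub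
    obtain ⟨x, hxy⟩ := hsub hy
    exact absurd hxy (hf' x (mem_univ x))

theorem eventually_residual_exists_mem_interior_cellSet {m n : ℕ} (hmn : n ≤ m) :
    ∀ᶠ f : C(Cube m, Fin n → ℝ) in residual C(Cube m, Fin n → ℝ), ∀ y ∈ interior (range f),
      ∃ M : ℕ, 0 < M ∧ ∃ k : Fin m → Fin (2 * M), y ∈ interior (f '' cellSet k) := by
  filter_upwards [eventually_countable_forall.2 fun p : ℕ × ℕ =>
    eventually_residual_forall_mem_closedBall_cellSet (m := m) hmn
      (denseSeq (Fin n → ℝ) p.1) ((p.2 : ℝ) + 1)⁻¹] with f hf y hy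
  obtain ⟨q, l, hsub, hmem⟩ := exists_closedBall_denseSeq_subset hy
  exact hf (q, l) hsub y hmem

/-- Extension of Kirchheim's theorem: generic fibers on the cube `[0,1]^m`. -/
theorem stmt11 (m n : ℕ) (hm : 0 < m) (hn : 0 < n) (hmn : n ≤ m) :
    ∀ᶠ (f : C(↥(Set.Icc (0 : Fin m → ℝ) 1), Fin n → ℝ)) in residual C(↥(Set.Icc (0 : Fin m → ℝ) 1), Fin n → ℝ),
      ∀ y ∈ interior (Set.range ⇑f),
        tdim (⇑f ⁻¹' {y}) = (m : EReal) - (n : EReal) ∧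
        hdim (⇑f ⁻¹' {y}) = (m : EReal) - (n : EReal) ∧
        pdim (⇑f ⁻¹' {y}) = (m : EReal) := by
  filter_upwards [eventually_residual_dimH_fiber_le hmn, eventually_residual_richlyPacked hmn,
    eventually_residual_exists_mem_interior_cellSet hmn] with f h1 h2 h3 y hy
  obtain ⟨M, hM, k, hk⟩ := h3 y hy
  obtain ⟨-, h4, h5⟩ := h2 M k 0 y hM hk
  obtain ⟨x, hx⟩ := interior_subset hy
  have hne : (f ⁻¹' {y}).Nonempty := ⟨x, hx⟩
  have hcast : (m : EReal) - (n : EReal) = ((m - n : ℕ) : EReal) := by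
    have : (((m : ℝ) - (n : ℝ) : ℝ) : EReal) = (((m - n : ℕ) : ℝ) : EReal) := by
      rw [Nat.cast_sub hmn]
    simpa using this
  refine ⟨?_, ?_, pdim_fiber_eq (fun M k N hM hy => (h2 M k N y hM hy).1) hm hM k hk⟩
  · rw [hcast]
    exact indDim_eq_of_indBelow _ (indBelow_of_dimH_le _ _ (h1 y)) h4
  · rw [hcast, hdim, if_neg hne.ne_empty, le_antisymm (h1 y) h5]
    rw [← ENNReal.coe_natCast]
    rfl
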